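/- arXiv:1305.3037 — 3 statements merged into one kernel-verified Lean document; each statement's English description precedes it below -/
import Mathlib

section
/- Let $d\ge 1$ and $0<\lambda<d$. Suppose $\alpha\ge 0$ when $0<\lambda<d/2$, and $\alpha>\lambda-d/2$ when $d/2\le\lambda<d$. Then there exists a constant $C=C(\alpha,\lambda,d)$ such that for all $f\in L^1\cap\dot H^\alpha(\mathbb{R}^d)$, $\sup_{v\in\mathbb{R}^d}\int_{\mathbb{R}^d}|v-v_*|^{-\lambda}\,|f(v_*)|\,dv_* \le C\,\|f\|_{L^1}^{1-\theta}\,\|f\|_{\dot H^\alpha}^{\theta}$ where $\theta = 2\lambda/(d+2\alpha)\in(0,1)$. -/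
open MeasureTheory FourierTransform ENNReal
open scoped NNReal

noncomputable def L1e (d : ℕ) (f : EuclideanSpace ℝ (Fin d) → ℂ) : ℝ≥0∞ :=
  ∫⁻ v, ‖f v‖₊

noncomputable def He (d : ℕ) (s : ℝ) (f : EuclideanSpace ℝ (Fin d) → ℂ) : ℝ≥0∞ :=
  (∫⁻ ξ, (‖ξ‖₊ : ℝ≥0∞) ^ (2 * s) * (‖𝓕 f ξ‖₊ : ℝ≥0∞) ^ (2 : ℝ)) ^ ((1 : ℝ) / 2)

section FourierSplit

variable {V : Type*} [NormedAddCommGroup V] [InnerProductSpace ℝ V] [FiniteDimensional ℝ V]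
  [MeasurableSpace V] [BorelSpace V]

open SchwartzMap in
lemma integral_fourierInv_smul_schwartz {a : V → ℂ} (ha : Integrable a) (G : 𝓢(V, ℂ)) :
    ∫ x, G x • 𝓕⁻ a x = ∫ ξ, (𝓕⁻ G) ξ • a ξ := by
  have h := VectorFourier.integral_fourierIntegral_smul_eq_flip (L := -innerₗ V) (μ := volume)
    (ν := volume) Real.continuous_fourierChar (by simpa using! continuous_inner.neg) G.integrable ha
  have e : (-innerₗ V).flip = -innerₗ V := by
    ext x y; simp [real_inner_comm]
  rw [e] at h
  rw [fourierInv_coe]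
  exact h.symm

open SchwartzMap in
lemma integral_schwartz_smul_eq_fourier {f : V → ℂ} (hf : Integrable f) (G : 𝓢(V, ℂ)) :
    ∫ x, G x • f x = ∫ ξ, (𝓕⁻ G) ξ • 𝓕 f ξ := by
  have h := VectorFourier.integral_fourierIntegral_smul_eq_flip (L := innerₗ V) (μ := volume)
    (ν := volume) Real.continuous_fourierChar (by simpa using! continuous_inner)
    (𝓕⁻ G).integrable hf
  have e : (innerₗ V).flip = innerₗ V := by
    ext x y; simp
  rw [e] at h
  have h2 : 𝓕 ((𝓕⁻ G : 𝓢(V, ℂ)) : V → ℂ) = G := by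
    rw [← fourier_coe, FourierTransform.fourier_fourierInv_eq]
  calc _ = ∫ x, 𝓕 ((𝓕⁻ G : 𝓢(V, ℂ)) : V → ℂ) x • f x := by rw [h2]
    _ = _ := h

/-- If the Fourier transform of an integrable function is the sum of an integrable function and a
square integrable one, the function is the sum of their inverse Fourier transforms. -/
lemma ae_eq_fourierInv_add_of_fourier_eq_add {f a b : V → ℂ} (hf : Integrable f)
    (ha : Integrable a) (hb : MemLp b 2) (hab : 𝓕 f = a + b) :
    f =ᵐ[volume] fun x ↦ 𝓕⁻ a x + (𝓕⁻ (hb.toLp b) : Lp ℂ 2 (volume : Measure V)) x := by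
  have hca : Continuous (𝓕⁻ a) :=
    VectorFourier.fourierIntegral_continuous Real.continuous_fourierChar
      (by simpa using! continuous_inner.neg) ha
  have hh : LocallyIntegrable (𝓕⁻ (hb.toLp b) : Lp ℂ 2 (volume : Measure V)) :=
    (Lp.memLp _).locallyIntegrable (by norm_num)
  refine ae_eq_of_integral_contDiff_smul_eq hf.locallyIntegrable
    (hca.locallyIntegrable.add hh) fun g g_smooth g_cpt ↦ ?_
  have hg₁ : HasCompactSupport (Complex.ofRealCLM ∘ g) := g_cpt.comp_left rfl
  have hg₂ : ContDiff ℝ (⊤ : ℕ∞) (Complex.ofRealCLM ∘ g) := by fun_prop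
  set G := hg₁.toSchwartzMap hg₂ with hG
  have hGg : ∀ x (z : ℂ), g x • z = G x • z := by intro x z; simp [hG]
  simp_rw [hGg, smul_add]
  have key := congrArg (fun T ↦ T G) (Lp.fourierInv_toTemperedDistribution_eq (hb.toLp b))
  simp only [TemperedDistribution.fourierInv_apply, Lp.toTemperedDistribution_apply] at key
  have e1 : ∫ ξ, (𝓕⁻ G) ξ • (hb.toLp b) ξ = ∫ ξ, (𝓕⁻ G) ξ • b ξ := by
    apply integral_congr_ae
    filter_upwards [hb.coeFn_toLp] with x hx
    rw [hx]
  rw [integral_add, ← key, e1, integral_fourierInv_smul_schwartz ha,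
    integral_schwartz_smul_eq_fourier hf, hab, ← integral_add]
  · simp [mul_add]
  · exact ha.bdd_smul _ (𝓕⁻ G).continuous.aestronglyMeasurable
      (Filter.Eventually.of_forall fun x ↦ (𝓕⁻ G).norm_le_seminorm ℝ x)
  · exact memLp_one_iff_integrable.1 (hb.smul ((𝓕⁻ G).memLp 2))
  · exact hca.locallyIntegrable.integrable_smul_left_of_hasCompactSupport G.continuous hg₁
  · exact hh.integrable_smul_left_of_hasCompactSupport G.continuous hg₁

end FourierSplit

section PowerWeights

open Set Metric

lemma lintegral_Ioc_zero_rpow {p T : ℝ} (hp : 0 < p) (hT : 0 < T) :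
    ∫⁻ t in Ioc 0 T, ENNReal.ofReal (t ^ (p - 1)) = ENNReal.ofReal (T ^ p / p) := by
  have hi : IntegrableOn (fun t : ℝ ↦ t ^ (p - 1)) (Ioc 0 T) :=
    (intervalIntegrable_iff_integrableOn_Ioc_of_le hT.le).1
      (intervalIntegral.intervalIntegrable_rpow' (by linarith))
  rw [← ofReal_integral_eq_lintegral_ofReal hi, ← intervalIntegral.integral_of_le hT.le,
    integral_rpow (Or.inl (by linarith))]
  · simp [hp.ne']
  · filter_upwards [ae_restrict_mem measurableSet_Ioc] with t ht
    exact Real.rpow_nonneg ht.1.le _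

lemma lintegral_Ioi_rpow {p T : ℝ} (hp : 0 < p) (hT : 0 < T) :
    ∫⁻ t in Ioi T, ENNReal.ofReal (t ^ (-p - 1)) = ENNReal.ofReal (T ^ (-p) / p) := by
  have hi : IntegrableOn (fun t : ℝ ↦ t ^ (-p - 1)) (Ioi T) :=
    integrableOn_Ioi_rpow_of_lt (by linarith) hT
  rw [← ofReal_integral_eq_lintegral_ofReal hi, integral_Ioi_rpow_of_lt (by linarith) hT]
  · congr 1
    rw [sub_add_cancel, neg_div_neg_eq]
  · filter_upwards [ae_restrict_mem measurableSet_Ioi] with t ht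
    exact Real.rpow_nonneg (hT.trans ht).le _

variable {V : Type*} [NormedAddCommGroup V] [InnerProductSpace ℝ V] [FiniteDimensional ℝ V]
  [MeasurableSpace V] [BorelSpace V]

lemma lintegral_ball_enorm_rpow_neg_lt_top (hd : 1 ≤ Module.finrank ℝ V) {γ : ℝ}
    (hγ : γ < Module.finrank ℝ V) : ∫⁻ x in ball (0 : V) 1, ‖x‖ₑ ^ (-γ) < ⊤ := by
  have : Nontrivial V := Module.nontrivial_of_finrank_pos (R := ℝ) (by omega)
  have hm : Measurable fun x : V ↦ ‖x‖ ^ (-γ) := measurable_norm.pow_const _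
  have hi : IntegrableOn (fun x : V ↦ ‖x‖ ^ (-γ)) (ball 0 1) :=
    integrableOn_ball_of_norm_le_rpow (C := 1) hd hγ
      (Filter.Eventually.of_forall fun x ↦ by
        rw [one_mul, Real.norm_of_nonneg (Real.rpow_nonneg (norm_nonneg x) _)])
      hm.aestronglyMeasurable
  refine lt_of_eq_of_lt (lintegral_congr_ae ?_) hi.2
  have h0 : ∀ᵐ x : V, x ≠ 0 := by simp [ae_iff]
  filter_upwards [ae_restrict_of_ae h0] with x hx
  rw [← ofReal_norm, ← ofReal_norm,
    ENNReal.ofReal_rpow_of_pos (norm_pos_iff.2 hx),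
    Real.norm_of_nonneg (Real.rpow_nonneg (norm_nonneg x) _)]

lemma exists_lintegral_ball_enorm_rpow_neg_eq (hd : 1 ≤ Module.finrank ℝ V) {γ : ℝ}
    (hγ : γ < Module.finrank ℝ V) : ∃ c : ℝ≥0, ∀ N : ℝ, 0 < N →
      ∫⁻ x in ball (0 : V) N, ‖x‖ₑ ^ (-γ) = c * ENNReal.ofReal N ^ (Module.finrank ℝ V - γ) := by
  refine ⟨(∫⁻ x in ball (0 : V) 1, ‖x‖ₑ ^ (-γ)).toNNReal, fun N hN ↦ ?_⟩
  rw [ENNReal.coe_toNNReal (lintegral_ball_enorm_rpow_neg_lt_top hd hγ).ne]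
  have hN0 : ENNReal.ofReal N ≠ 0 := by simpa using hN
  have hNt : ENNReal.ofReal N ≠ ⊤ := ENNReal.ofReal_ne_top
  set n := Module.finrank ℝ V
  have hF : Measurable ((ball (0 : V) N).indicator fun x ↦ ‖x‖ₑ ^ (-γ)) :=
    (measurable_enorm.pow_const _).indicator measurableSet_ball
  have h := lintegral_map (μ := (volume : Measure V)) hF
    (measurable_const_smul N)
  rw [show Measure.map (fun x : V ↦ N • x) volume = _ from
    Measure.map_addHaar_smul (volume : Measure V) hN.ne', lintegral_smul_measure,
    lintegral_indicator measurableSet_ball] at h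
  have e : ∀ x : V, (ball (0 : V) N).indicator (fun x ↦ ‖x‖ₑ ^ (-γ)) (N • x) =
      ENNReal.ofReal N ^ (-γ) * (ball (0 : V) 1).indicator (fun x ↦ ‖x‖ₑ ^ (-γ)) x := by
    intro x
    have hmem : N • x ∈ ball (0 : V) N ↔ x ∈ ball (0 : V) 1 := by
      simp [norm_smul, abs_of_pos hN, mul_lt_iff_lt_one_right hN]
    by_cases hx : x ∈ ball (0 : V) 1
    · rw [indicator_of_mem (hmem.2 hx), indicator_of_mem hx, enorm_smul,
        ENNReal.mul_rpow_of_ne_top (by simp) (by simp), Real.enorm_of_nonneg hN.le]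
    · rw [indicator_of_notMem (mt hmem.1 hx), indicator_of_notMem hx, mul_zero]
  simp_rw [e] at h
  rw [lintegral_const_mul _ ((measurable_enorm.pow_const _).indicator measurableSet_ball),
    lintegral_indicator measurableSet_ball, abs_of_pos (by positivity), smul_eq_mul,
    ENNReal.ofReal_inv_of_pos (by positivity), ENNReal.ofReal_pow hN.le] at h
  have hp0 : ENNReal.ofReal N ^ n ≠ 0 := pow_ne_zero _ hN0
  have hpt : ENNReal.ofReal N ^ n ≠ ⊤ := ENNReal.pow_ne_top hNt
  calc _ = ENNReal.ofReal N ^ n * ((ENNReal.ofReal N ^ n)⁻¹ *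
        ∫⁻ x in ball (0 : V) N, ‖x‖ₑ ^ (-γ)) := by
        rw [← mul_assoc, ENNReal.mul_inv_cancel hp0 hpt, one_mul]
    _ = _ := by
        rw [h, ← mul_assoc, sub_eq_add_neg, ENNReal.rpow_add _ _ hN0 hNt, ENNReal.rpow_natCast,
          mul_comm]

/-- A function with small mass on small balls has a bounded Riesz potential. -/
lemma lintegral_enorm_rpow_neg_mul_le (hd : 1 ≤ Module.finrank ℝ V) {f : V → ℂ}
    (hf : AEStronglyMeasurable f) {lam s : ℝ} (hlam : 0 < lam) (hs : lam < s) {K : ℝ≥0∞} (v : V)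
    (hK : ∀ r : ℝ, 0 < r → ∫⁻ w in ball v r, ‖f w‖ₑ ≤ ENNReal.ofReal r ^ s * K)
    {R : ℝ} (hR : 0 < R) :
    ∫⁻ w, ‖v - w‖ₑ ^ (-lam) * ‖f w‖ₑ ≤ ENNReal.ofReal R ^ lam * (∫⁻ w, ‖f w‖ₑ) +
      ENNReal.ofReal (lam / (s - lam)) * ENNReal.ofReal R ^ (lam - s) * K := by
  have : Nontrivial V := Module.nontrivial_of_finrank_pos (R := ℝ) (by omega)
  set μ := (volume : Measure V).withDensity fun w ↦ ‖f w‖ₑ with hμ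
  have hmeas : Measurable fun w : V ↦ ‖v - w‖⁻¹ := by fun_prop
  have h1 : ∫⁻ w, ‖v - w‖ₑ ^ (-lam) * ‖f w‖ₑ = ∫⁻ w, ENNReal.ofReal (‖v - w‖⁻¹ ^ lam) ∂μ := by
    rw [hμ, lintegral_withDensity_eq_lintegral_mul₀' hf.enorm
      (by fun_prop)]
    apply lintegral_congr_ae
    have h0 : ∀ᵐ w : V, w ≠ v := by simp [ae_iff]
    filter_upwards [h0] with w hw
    have hpos : 0 < ‖v - w‖ := norm_pos_iff.2 (sub_ne_zero.2 hw.symm)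
    rw [Pi.mul_apply, mul_comm, ← ofReal_norm (v - w), ENNReal.ofReal_rpow_of_pos hpos,
      Real.rpow_neg hpos.le, Real.inv_rpow hpos.le]
  rw [h1, lintegral_rpow_eq_lintegral_meas_lt_mul μ
    (Filter.Eventually.of_forall fun w ↦ by positivity) hmeas.aemeasurable hlam,
    ← Ioc_union_Ioi_eq_Ioi hR.le,
    lintegral_union measurableSet_Ioi (Ioc_disjoint_Ioi le_rfl), mul_add]
  have hR0 : ENNReal.ofReal R ≠ 0 := by simpa using hR
  gcongr ?_ + ?_
  · calc _ ≤ ENNReal.ofReal lam * ∫⁻ t in Ioc 0 R, (∫⁻ w, ‖f w‖ₑ) * ENNReal.ofReal (t ^ (lam - 1)) := by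
          gcongr with t
          exact (measure_mono (subset_univ _)).trans_eq (by simp [hμ])
      _ = _ := by
          rw [lintegral_const_mul _ (by fun_prop), lintegral_Ioc_zero_rpow hlam hR,
            mul_left_comm, ← ENNReal.ofReal_mul hlam.le, mul_div_cancel₀ _ hlam.ne',
            ENNReal.ofReal_rpow_of_pos hR, mul_comm]
  · calc _ ≤ ENNReal.ofReal lam * ∫⁻ t in Ioi R, K * ENNReal.ofReal (t ^ (-(s - lam) - 1)) := by
          gcongr 1
          refine setLIntegral_mono (by fun_prop) fun t ht ↦ ?_
          have ht0 : 0 < t := hR.trans ht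
          have hsub : {w : V | t < ‖v - w‖⁻¹} ⊆ ball v t⁻¹ := fun w hw ↦ by
            have hw' : t < ‖v - w‖⁻¹ := hw
            rw [mem_ball', dist_eq_norm]
            exact (lt_inv_comm₀ ht0 (inv_pos.1 (ht0.trans hw'))).1 hw'
          have hb : μ {w : V | t < ‖v - w‖⁻¹} ≤ ENNReal.ofReal (t ^ (-s)) * K := by
            refine (measure_mono hsub).trans ?_
            rw [hμ, withDensity_apply _ measurableSet_ball]
            refine (hK _ (inv_pos.2 ht0)).trans_eq ?_
            rw [ENNReal.ofReal_rpow_of_pos (inv_pos.2 ht0), Real.inv_rpow ht0.le,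
              Real.rpow_neg ht0.le]
          calc _ ≤ ENNReal.ofReal (t ^ (-s)) * K * ENNReal.ofReal (t ^ (lam - 1)) := by gcongr
            _ = K * ENNReal.ofReal (t ^ (-s) * t ^ (lam - 1)) := by
                rw [ENNReal.ofReal_mul (by positivity)]; ring
            _ = _ := by rw [← Real.rpow_add ht0]; congr 3; ring
      _ = _ := by
          rw [lintegral_const_mul _ (by fun_prop), lintegral_Ioi_rpow (sub_pos.2 hs) hR,
            mul_left_comm, ← ENNReal.ofReal_mul hlam.le, ENNReal.ofReal_rpow_of_pos hR,
            ← ENNReal.ofReal_mul (div_nonneg hlam.le (sub_pos.2 hs).le), mul_comm, neg_sub]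
          congr 2
          ring

end PowerWeights

section Interpolation

open Set Metric

/-- If `X ≤ C (R ^ p A + R ^ (p - m) H)` for all scales `R`, the optimal choice of `R` gives a
multiplicative bound. -/
lemma le_rpow_mul_rpow_of_forall_scale {X A H C : ℝ≥0∞} (hA : A ≠ ⊤) (hH : H ≠ ⊤) (hC : C ≠ ⊤)
    {p m : ℝ} (hp : 0 < p) (hpm : p < m)
    (h : ∀ R : ℝ, 0 < R →
      X ≤ C * (ENNReal.ofReal R ^ p * A + ENNReal.ofReal R ^ (p - m) * H)) :
    X ≤ C * 2 * (A ^ (1 - p / m) * H ^ (p / m)) := by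
  have hm : 0 < m := hp.trans hpm
  have hθ : p / m < 1 := (div_lt_one hm).2 hpm
  have main : ∀ a b : ℝ≥0∞, A ≤ a → H ≤ b → a ≠ 0 → b ≠ 0 → a ≠ ⊤ → b ≠ ⊤ →
      X ≤ C * 2 * (a ^ (1 - p / m) * b ^ (p / m)) := by
    intro a b hAa hHb ha0 hb0 hat hbt
    have hq0 : b * a⁻¹ ≠ 0 := mul_ne_zero hb0 (ENNReal.inv_ne_zero.2 hat)
    have hqt : b * a⁻¹ ≠ ⊤ := ENNReal.mul_ne_top hbt (ENNReal.inv_ne_top.2 ha0)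
    have hR0 : (b * a⁻¹) ^ (1 / m) ≠ 0 := by simp [ENNReal.rpow_eq_zero_iff, hq0, hqt]
    have hRt : (b * a⁻¹) ^ (1 / m) ≠ ⊤ := ENNReal.rpow_ne_top_of_nonneg (by positivity) hqt
    have hpow : ∀ y : ℝ, (b * a⁻¹) ^ y = b ^ y * a ^ (-y) := fun y ↦ by
      rw [ENNReal.mul_rpow_of_ne_zero hb0 (ENNReal.inv_ne_zero.2 hat), ENNReal.inv_rpow,
        ENNReal.rpow_neg]
    refine (h _ (ENNReal.toReal_pos hR0 hRt)).trans ?_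
    rw [ENNReal.ofReal_toReal hRt, ← ENNReal.rpow_mul, ← ENNReal.rpow_mul, hpow, hpow, mul_assoc C]
    gcongr C * ?_
    have e1 : b ^ (1 / m * p) * a ^ (-(1 / m * p)) * a = a ^ (1 - p / m) * b ^ (p / m) := by
      nth_rw 2 [← ENNReal.rpow_one a]
      rw [mul_assoc, ← ENNReal.rpow_add _ _ ha0 hat, mul_comm]
      ring_nf
    have e2 : b ^ (1 / m * (p - m)) * a ^ (-(1 / m * (p - m))) * b =
        a ^ (1 - p / m) * b ^ (p / m) := by
      nth_rw 2 [← ENNReal.rpow_one b]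
      rw [mul_right_comm, ← ENNReal.rpow_add _ _ hb0 hbt, mul_comm]
      congr 2 <;> field_simp <;> ring
    calc _ ≤ b ^ (1 / m * p) * a ^ (-(1 / m * p)) * a +
          b ^ (1 / m * (p - m)) * a ^ (-(1 / m * (p - m))) * b := by gcongr
      _ = _ := by rw [e1, e2, two_mul]
  have hlim : Filter.Tendsto
      (fun ε : ℝ≥0∞ ↦ C * 2 * ((A + ε) ^ (1 - p / m) * (H + ε) ^ (p / m)))
      (nhdsWithin 0 (Ioo 0 ⊤)) (nhds (C * 2 * (A ^ (1 - p / m) * H ^ (p / m)))) := by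
    have hlimit : ∀ (a : ℝ≥0∞) (y : ℝ), Filter.Tendsto (fun ε : ℝ≥0∞ ↦ (a + ε) ^ y)
        (nhdsWithin 0 (Ioo 0 ⊤)) (nhds (a ^ y)) := fun a y ↦ by
      have hc : Continuous fun ε : ℝ≥0∞ ↦ (a + ε) ^ y :=
        ENNReal.continuous_rpow_const.comp (by fun_prop)
      simpa using (hc.tendsto 0).mono_left nhdsWithin_le_nhds
    have hAt : A ^ (1 - p / m) ≠ ⊤ := ENNReal.rpow_ne_top_of_nonneg (by linarith) hA
    have hHt : H ^ (p / m) ≠ ⊤ := ENNReal.rpow_ne_top_of_nonneg (by positivity) hH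
    exact ENNReal.Tendsto.const_mul
      (ENNReal.Tendsto.mul (hlimit _ _) (Or.inr hHt) (hlimit _ _) (Or.inr hAt))
      (Or.inr (ENNReal.mul_ne_top hC (by simp)))
  have : (nhdsWithin (0 : ℝ≥0∞) (Ioo 0 ⊤)).NeBot := left_nhdsWithin_Ioo_neBot (by simp)
  refine ge_of_tendsto hlim ?_
  filter_upwards [self_mem_nhdsWithin] with ε hε
  exact main _ _ le_self_add le_self_add (by simp [hε.1.ne']) (by simp [hε.1.ne'])
    (ENNReal.add_ne_top.2 ⟨hA, hε.2.ne⟩) (ENNReal.add_ne_top.2 ⟨hH, hε.2.ne⟩)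

variable {V : Type*} [NormedAddCommGroup V] [InnerProductSpace ℝ V] [FiniteDimensional ℝ V]
  [MeasurableSpace V] [BorelSpace V]

/-- The homogeneous Sobolev seminorm of order `s`. -/
noncomputable def homogeneousSobolevNorm (s : ℝ) (f : V → ℂ) : ℝ≥0∞ :=
  (∫⁻ ξ, ‖ξ‖ₑ ^ (2 * s) * ‖𝓕 f ξ‖ₑ ^ (2 : ℝ)) ^ ((1 : ℝ) / 2)

lemma homogeneousSobolevNorm_rpow_two (s : ℝ) (f : V → ℂ) :
    homogeneousSobolevNorm s f ^ (2 : ℝ) = ∫⁻ ξ, ‖ξ‖ₑ ^ (2 * s) * ‖𝓕 f ξ‖ₑ ^ (2 : ℝ) := by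
  rw [homogeneousSobolevNorm, ← ENNReal.rpow_mul]
  norm_num

lemma continuous_fourier_of_integrable {f : V → ℂ} (hf : Integrable f) : Continuous (𝓕 f) :=
  VectorFourier.fourierIntegral_continuous Real.continuous_fourierChar
    (by simpa using! continuous_inner) hf

lemma enorm_fourier_le (f : V → ℂ) (ξ : V) : ‖𝓕 f ξ‖ₑ ≤ ∫⁻ x, ‖f x‖ₑ := by
  rw [Real.fourier_eq]
  refine (enorm_integral_le_lintegral_enorm _).trans_eq ?_
  exact lintegral_congr fun _ ↦ by rw [← ofReal_norm, Circle.norm_smul, ofReal_norm]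

lemma enorm_fourierInv_le (f : V → ℂ) (x : V) : ‖𝓕⁻ f x‖ₑ ≤ ∫⁻ ξ, ‖f ξ‖ₑ := by
  rw [Real.fourierInv_eq]
  refine (enorm_integral_le_lintegral_enorm _).trans_eq ?_
  exact lintegral_congr fun _ ↦ by rw [← ofReal_norm, Circle.norm_smul, ofReal_norm]

lemma rpow_two_mul_rpow_half (a : ℝ≥0∞) (y : ℝ) : (a ^ (2 * y)) ^ ((1 : ℝ) / 2) = a ^ y := by
  rw [← ENNReal.rpow_mul]
  ring_nf

lemma exists_homogeneousSobolevNorm_le (hd : 1 ≤ Module.finrank ℝ V) {α β : ℝ} (hβ : 0 ≤ β)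
    (hβα : β ≤ α) : ∃ C : ℝ≥0, ∀ f : V → ℂ, Integrable f → ∀ R : ℝ, 0 < R →
      homogeneousSobolevNorm β f ≤
        C * (ENNReal.ofReal R ^ ((Module.finrank ℝ V : ℝ) / 2 + β) * (∫⁻ x, ‖f x‖ₑ) +
          ENNReal.ofReal R ^ (β - α) * homogeneousSobolevNorm α f) := by
  have hn : (1 : ℝ) ≤ Module.finrank ℝ V := by exact_mod_cast hd
  obtain ⟨c, hc⟩ := exists_lintegral_ball_enorm_rpow_neg_eq (V := V) hd
    (γ := -(2 * β)) (by linarith)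
  refine ⟨c ^ ((1 : ℝ) / 2) + 1, fun f hf R hR ↦ ?_⟩
  set A := ∫⁻ x, ‖f x‖ₑ
  set n := (Module.finrank ℝ V : ℝ)
  set r := ENNReal.ofReal R
  have hr0 : r ≠ 0 := by simpa [r] using hR
  have hrt : r ≠ ⊤ := ENNReal.ofReal_ne_top
  have low : ∫⁻ ξ in ball (0 : V) R, ‖ξ‖ₑ ^ (2 * β) * ‖𝓕 f ξ‖ₑ ^ (2 : ℝ) ≤
      c * r ^ (2 * (n / 2 + β)) * A ^ (2 * (1 : ℝ)) := by
    calc _ ≤ ∫⁻ ξ in ball (0 : V) R, ‖ξ‖ₑ ^ (2 * β) * A ^ (2 : ℝ) := by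
          gcongr with ξ
          exact enorm_fourier_le f ξ
      _ = _ := by
          rw [lintegral_mul_const _ (measurable_enorm.pow_const _)]
          have := hc R hR
          rw [neg_neg] at this
          rw [this, mul_one]
          congr 3
          ring
  have high : ∫⁻ ξ in (ball (0 : V) R)ᶜ, ‖ξ‖ₑ ^ (2 * β) * ‖𝓕 f ξ‖ₑ ^ (2 : ℝ) ≤
      r ^ (2 * (β - α)) * homogeneousSobolevNorm α f ^ (2 * (1 : ℝ)) := by
    rw [mul_one, homogeneousSobolevNorm_rpow_two, ← lintegral_const_mul' _ _
      (by simp [ENNReal.rpow_eq_top_iff, hr0, hrt])]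
    refine (setLIntegral_mono_ae' measurableSet_ball.compl
      (Filter.Eventually.of_forall fun ξ hξ ↦ ?_)).trans (setLIntegral_le_lintegral _ _)
    have hRξ : r ≤ ‖ξ‖ₑ := by
      rw [← ofReal_norm]
      exact ENNReal.ofReal_le_ofReal (by simpa using hξ)
    have hξ0 : ‖ξ‖ₑ ≠ 0 := (hr0.bot_lt.trans_le hRξ).ne'
    rw [← mul_assoc]
    gcongr
    calc ‖ξ‖ₑ ^ (2 * β) = ‖ξ‖ₑ ^ (-(2 * (α - β))) * ‖ξ‖ₑ ^ (2 * α) := by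
          rw [← ENNReal.rpow_add _ _ hξ0 (by simp)]
          ring_nf
      _ ≤ r ^ (-(2 * (α - β))) * ‖ξ‖ₑ ^ (2 * α) := by
          rw [ENNReal.rpow_neg, ENNReal.rpow_neg]
          gcongr
      _ = _ := by ring_nf
  rw [homogeneousSobolevNorm, ← lintegral_add_compl _ (measurableSet_ball (x := (0 : V)) (ε := R))]
  refine (ENNReal.rpow_le_rpow (add_le_add low high) (by norm_num)).trans ?_
  refine (ENNReal.rpow_add_le_add_rpow _ _ (by norm_num) (by norm_num)).trans ?_
  have hh : (0 : ℝ) ≤ 1 / 2 := by norm_num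
  rw [ENNReal.mul_rpow_of_nonneg _ _ hh, ENNReal.mul_rpow_of_nonneg _ _ hh,
    ENNReal.mul_rpow_of_nonneg _ _ hh, rpow_two_mul_rpow_half, rpow_two_mul_rpow_half,
    rpow_two_mul_rpow_half, rpow_two_mul_rpow_half, ENNReal.rpow_one, ENNReal.rpow_one,
    ENNReal.coe_add, ENNReal.coe_one, ENNReal.coe_rpow_of_nonneg _ hh, mul_add, mul_assoc]
  refine add_le_add ?_ ?_
  · gcongr
    exact le_self_add
  · rw [add_mul, one_mul]
    exact le_add_self

/-- Mass of a function on small balls, controlled by a homogeneous Sobolev norm of order below half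
the dimension. -/
lemma exists_lintegral_ball_enorm_le (hd : 1 ≤ Module.finrank ℝ V) {β : ℝ} (hβ : 0 ≤ β)
    (hβn : 2 * β < Module.finrank ℝ V) : ∃ C : ℝ≥0, ∀ f : V → ℂ, Integrable f →
      homogeneousSobolevNorm β f ≠ ⊤ → ∀ (v : V) (r : ℝ), 0 < r →
      ∫⁻ w in ball v r, ‖f w‖ₑ ≤ ENNReal.ofReal r ^ ((Module.finrank ℝ V : ℝ) / 2 + β) *
        (C * homogeneousSobolevNorm β f) := by
  have : Nontrivial V := Module.nontrivial_of_finrank_pos (R := ℝ) (by omega)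
  obtain ⟨c, hc⟩ := exists_lintegral_ball_enorm_rpow_neg_eq (V := V) hd hβn
  set ω : ℝ≥0 := (volume (ball (0 : V) 1)).toNNReal with hω
  have hωc : (ω : ℝ≥0∞) = volume (ball (0 : V) 1) := ENNReal.coe_toNNReal measure_ball_lt_top.ne
  refine ⟨ω * c ^ ((1 : ℝ) / 2) + ω ^ ((1 : ℝ) / 2), fun f hf hfin v r hr ↦ ?_⟩
  set H := homogeneousSobolevNorm β f with hH
  set n := (Module.finrank ℝ V : ℝ) with hn
  set ρ := ENNReal.ofReal r with hρ
  have hρ0 : ρ ≠ 0 := by simpa [ρ] using hr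
  have hρt : ρ ≠ ⊤ := ENNReal.ofReal_ne_top
  have hh : (0 : ℝ) ≤ 1 / 2 := by norm_num
  have hinv : ENNReal.ofReal r⁻¹ = ρ⁻¹ := ENNReal.ofReal_inv_of_pos hr
  have hvol : volume (ball v r) = ω * ρ ^ n := by
    rw [Measure.addHaar_ball _ _ hr.le, hωc, ENNReal.ofReal_pow hr.le, hn, ENNReal.rpow_natCast,
      mul_comm]
  have hcont := continuous_fourier_of_integrable hf
  set S := ball (0 : V) r⁻¹ with hS
  have hSm : MeasurableSet S := measurableSet_ball
  have hw : Measurable fun ξ : V ↦ ‖ξ‖ₑ ^ β * ‖𝓕 f ξ‖ₑ :=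
    (measurable_enorm.pow_const _).mul hcont.measurable.enorm
  have hsq : ∀ ξ : V, (‖ξ‖ₑ ^ β * ‖𝓕 f ξ‖ₑ) ^ (2 : ℝ) =
      ‖ξ‖ₑ ^ (2 * β) * ‖𝓕 f ξ‖ₑ ^ (2 : ℝ) := fun ξ ↦ by
    rw [ENNReal.mul_rpow_of_nonneg _ _ (by norm_num), ← ENNReal.rpow_mul, mul_comm β]
  have low : ∫⁻ ξ, ‖S.indicator (𝓕 f) ξ‖ₑ ≤ c ^ ((1 : ℝ) / 2) * ρ ^ (β - n / 2) * H := by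
    have h0 : ∀ᵐ ξ : V, ξ ≠ 0 := by simp [ae_iff]
    calc _ = ∫⁻ ξ in S, ‖𝓕 f ξ‖ₑ := by
          simp_rw [enorm_indicator_eq_indicator_enorm]
          exact lintegral_indicator hSm _
      _ = ∫⁻ ξ in S, ((fun ξ ↦ ‖ξ‖ₑ ^ (-β)) * (fun ξ ↦ ‖ξ‖ₑ ^ β * ‖𝓕 f ξ‖ₑ) : V → ℝ≥0∞) ξ := by
          apply lintegral_congr_ae
          filter_upwards [ae_restrict_of_ae h0] with ξ hξ
          rw [Pi.mul_apply, ← mul_assoc, ← ENNReal.rpow_add _ _ (by simpa using hξ) (by simp)]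
          simp
      _ ≤ (∫⁻ ξ in S, (‖ξ‖ₑ ^ (-β)) ^ (2 : ℝ)) ^ ((1 : ℝ) / 2) *
          (∫⁻ ξ in S, (‖ξ‖ₑ ^ β * ‖𝓕 f ξ‖ₑ) ^ (2 : ℝ)) ^ ((1 : ℝ) / 2) :=
          ENNReal.lintegral_mul_le_Lp_mul_Lq _ Real.HolderConjugate.two_two
            (measurable_enorm.pow_const _).aemeasurable hw.aemeasurable
      _ ≤ (c * ρ ^ (2 * (β - n / 2))) ^ ((1 : ℝ) / 2) * H := by
          gcongr
          · rw [show 2 * (β - n / 2) = -(n - 2 * β) by ring, ENNReal.rpow_neg, ← ENNReal.inv_rpow,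
              ← hinv, ← hc _ (inv_pos.2 hr)]
            simp_rw [← ENNReal.rpow_mul]
            ring_nf
            exact le_rfl
          · rw [hH, homogeneousSobolevNorm]
            simp_rw [hsq]
            gcongr
            exact Measure.restrict_le_self
      _ = _ := by rw [ENNReal.mul_rpow_of_nonneg _ _ hh, rpow_two_mul_rpow_half]
  have high : eLpNorm (Sᶜ.indicator (𝓕 f)) 2 ≤ ρ ^ β * H := by
    rw [eLpNorm_eq_lintegral_rpow_enorm_toReal (by norm_num) (by norm_num), ENNReal.toReal_ofNat]
    calc _ ≤ (ρ ^ (2 * β) * H ^ (2 * (1 : ℝ))) ^ ((1 : ℝ) / 2) := by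
          gcongr
          rw [mul_one, hH, homogeneousSobolevNorm_rpow_two,
            ← lintegral_const_mul' _ _ (by simp [ENNReal.rpow_eq_top_iff, hρ0, hρt])]
          gcongr with ξ
          by_cases hξ : ξ ∈ Sᶜ
          · rw [indicator_of_mem hξ, ← mul_assoc]
            refine le_mul_of_one_le_left' ?_
            rw [← ENNReal.mul_rpow_of_nonneg _ _ (by linarith)]
            refine (ENNReal.one_rpow (2 * β)).symm.trans_le (ENNReal.rpow_le_rpow ?_ (by linarith))
            have hξ' : r⁻¹ ≤ ‖ξ‖ := by simpa [hS] using hξ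
            rw [← ofReal_norm, hρ, ← ENNReal.ofReal_mul hr.le]
            rw [ENNReal.one_le_ofReal]
            calc (1 : ℝ) = r * r⁻¹ := (mul_inv_cancel₀ hr.ne').symm
              _ ≤ r * ‖ξ‖ := by gcongr
          · rw [indicator_of_notMem hξ]
            simp
      _ = _ := by
          rw [ENNReal.mul_rpow_of_nonneg _ _ hh, rpow_two_mul_rpow_half, rpow_two_mul_rpow_half,
            ENNReal.rpow_one]
  have ha : Integrable (S.indicator (𝓕 f)) := by
    rw [integrable_indicator_iff hSm]
    exact (hcont.continuousOn.integrableOn_compact (isCompact_closedBall (0 : V) r⁻¹)).mono_set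
      ball_subset_closedBall
  have hb : MemLp (Sᶜ.indicator (𝓕 f)) 2 :=
    ⟨(hcont.aestronglyMeasurable.indicator hSm.compl), high.trans_lt
      (ENNReal.mul_lt_top (ENNReal.rpow_lt_top_of_nonneg hβ hρt) hfin.lt_top)⟩
  have hfeq := ae_eq_fourierInv_add_of_fourier_eq_add hf ha hb
    (indicator_self_add_compl S (𝓕 f)).symm
  set h : Lp ℂ 2 (volume : Measure V) := 𝓕⁻ (hb.toLp _) with hh_def
  have hnorm : eLpNorm h 2 = eLpNorm (Sᶜ.indicator (𝓕 f)) 2 := by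
    rw [← Lp.enorm_def, ← Lp.enorm_toLp (hf := hb), ← ofReal_norm, ← ofReal_norm]
    congr 1
    exact (Lp.fourierTransformₗᵢ V ℂ).symm.norm_map _
  have hball : ∫⁻ w in ball v r, ‖h w‖ₑ ≤ (ω * ρ ^ n) ^ ((1 : ℝ) / 2) * (ρ ^ β * H) := by
    calc _ = ∫⁻ w in ball v r, ((fun _ ↦ 1) * (fun w ↦ ‖h w‖ₑ) : V → ℝ≥0∞) w := by simp
      _ ≤ (∫⁻ w in ball v r, 1 ^ (2 : ℝ)) ^ ((1 : ℝ) / 2) *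
          (∫⁻ w in ball v r, ‖h w‖ₑ ^ (2 : ℝ)) ^ ((1 : ℝ) / 2) :=
          ENNReal.lintegral_mul_le_Lp_mul_Lq _ Real.HolderConjugate.two_two
            aemeasurable_const (Lp.aestronglyMeasurable h).enorm.restrict
      _ ≤ (ω * ρ ^ n) ^ ((1 : ℝ) / 2) * eLpNorm h 2 := by
          rw [eLpNorm_eq_lintegral_rpow_enorm_toReal (by norm_num) (by norm_num),
            ENNReal.toReal_ofNat]
          gcongr
          · simp [hvol]
          · exact Measure.restrict_le_self
      _ ≤ _ := by
          rw [hnorm]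
          gcongr
  calc ∫⁻ w in ball v r, ‖f w‖ₑ
      ≤ ∫⁻ w in ball v r, (c ^ ((1 : ℝ) / 2) * ρ ^ (β - n / 2) * H + ‖h w‖ₑ) := by
        apply lintegral_mono_ae
        filter_upwards [ae_restrict_of_ae hfeq] with w hw
        rw [hw]
        refine (enorm_add_le _ _).trans ?_
        gcongr
        exact (enorm_fourierInv_le _ _).trans low
    _ ≤ c ^ ((1 : ℝ) / 2) * ρ ^ (β - n / 2) * H * (ω * ρ ^ n) +
        (ω * ρ ^ n) ^ ((1 : ℝ) / 2) * (ρ ^ β * H) := by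
        rw [lintegral_add_left measurable_const, setLIntegral_const, hvol]
        gcongr
    _ = _ := by
        have e1 : ρ ^ (n / 2 + β) = ρ ^ (β - n / 2) * ρ ^ n := by
          rw [← ENNReal.rpow_add _ _ hρ0 hρt]; ring_nf
        have e2 : ρ ^ (n / 2 + β) = ρ ^ (n / 2) * ρ ^ β := ENNReal.rpow_add _ _ hρ0 hρt
        have e3 : (ρ ^ n) ^ ((1 : ℝ) / 2) = ρ ^ (n / 2) := by
          rw [← ENNReal.rpow_mul]; ring_nf
        rw [ENNReal.mul_rpow_of_nonneg _ _ hh, e3, ENNReal.coe_add, ENNReal.coe_mul,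
          ENNReal.coe_rpow_of_nonneg _ hh, ENNReal.coe_rpow_of_nonneg _ hh, add_mul, mul_add]
        nth_rw 1 [e1]
        rw [e2]
        ring

end Interpolation

/-- A Sobolev order at most `α`, below half the dimension, and large enough for `|x| ^ (-lam)`. -/
lemma exists_subcritical_order {n lam α : ℝ} (hn : 0 < n) (hlamn : lam < n)
    (hα1 : lam < n / 2 → 0 ≤ α) (hα2 : n / 2 ≤ lam → α > lam - n / 2) :
    ∃ β, 0 ≤ β ∧ β ≤ α ∧ 2 * β < n ∧ lam < n / 2 + β := by
  rcases lt_or_ge lam (n / 2) with h | h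
  · exact ⟨0, le_rfl, hα1 h, by linarith, by linarith⟩
  · obtain ⟨β, hβ1, hβ2⟩ := exists_between (lt_min (hα2 h) (show lam - n / 2 < n / 2 by linarith))
    obtain ⟨hβα, hβn⟩ := lt_min_iff.1 hβ2
    exact ⟨β, by linarith, hβα.le, by linarith, by linarith⟩

lemma exists_rieszPotential_le {V : Type*} [NormedAddCommGroup V] [InnerProductSpace ℝ V]
    [FiniteDimensional ℝ V] [MeasurableSpace V] [BorelSpace V] (hd : 1 ≤ Module.finrank ℝ V)
    {lam α : ℝ} (hlam0 : 0 < lam) (hlamd : lam < Module.finrank ℝ V)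
    (hα1 : lam < (Module.finrank ℝ V : ℝ) / 2 → 0 ≤ α)
    (hα2 : (Module.finrank ℝ V : ℝ) / 2 ≤ lam → α > lam - (Module.finrank ℝ V : ℝ) / 2) :
    ∃ C : ℝ≥0, 0 < C ∧ ∀ f : V → ℂ, Integrable f → homogeneousSobolevNorm α f ≠ ⊤ → ∀ v : V,
      ∫⁻ w, ‖v - w‖ₑ ^ (-lam) * ‖f w‖ₑ ≤
        C * ((∫⁻ w, ‖f w‖ₑ) ^ (1 - lam / ((Module.finrank ℝ V : ℝ) / 2 + α)) *
          homogeneousSobolevNorm α f ^ (lam / ((Module.finrank ℝ V : ℝ) / 2 + α))) := by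
  obtain ⟨β, hβ0, hβα, hβn, hβ⟩ := exists_subcritical_order (hlam0.trans hlamd) hlamd hα1 hα2
  obtain ⟨C₁, hC₁⟩ := exists_lintegral_ball_enorm_le (V := V) hd hβ0 hβn
  obtain ⟨C₂, hC₂⟩ := exists_homogeneousSobolevNorm_le (V := V) hd hβ0 hβα
  set n := (Module.finrank ℝ V : ℝ)
  set k : ℝ≥0 := (lam / (n / 2 + β - lam)).toNNReal
  refine ⟨(1 + k * C₁ * C₂) * 2, by positivity, fun f hf hfin v ↦ ?_⟩
  have hA : ∫⁻ w, ‖f w‖ₑ ≠ ⊤ := hf.2.ne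
  have hβfin : homogeneousSobolevNorm β f ≠ ⊤ := by
    refine ((hC₂ f hf 1 one_pos).trans_lt ?_).ne
    simpa using ENNReal.mul_lt_top (by simp) (ENNReal.add_lt_top.2 ⟨hA.lt_top, hfin.lt_top⟩)
  rw [ENNReal.coe_mul, ENNReal.coe_ofNat]
  refine le_rpow_mul_rpow_of_forall_scale hA hfin ENNReal.coe_ne_top hlam0 (by linarith) fun R hR ↦ ?_
  refine (lintegral_enorm_rpow_neg_mul_le hd hf.1 hlam0 hβ v (hC₁ f hf hβfin v) hR).trans ?_
  have hR0 : ENNReal.ofReal R ≠ 0 := by simpa using hR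
  have hRt : ENNReal.ofReal R ≠ ⊤ := ENNReal.ofReal_ne_top
  have hle := hC₂ f hf R hR
  change _ + (k : ℝ≥0∞) * _ * _ ≤ _
  set A := ∫⁻ w, ‖f w‖ₑ
  set H := homogeneousSobolevNorm α f
  set r := ENNReal.ofReal R
  have e1 : r ^ lam = r ^ (lam - (n / 2 + β)) * r ^ (n / 2 + β) := by
    rw [← ENNReal.rpow_add _ _ hR0 hRt]; ring_nf
  have e2 : r ^ (lam - (n / 2 + α)) = r ^ (lam - (n / 2 + β)) * r ^ (β - α) := by
    rw [← ENNReal.rpow_add _ _ hR0 hRt]; ring_nf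
  calc _ ≤ r ^ lam * A + k * r ^ (lam - (n / 2 + β)) *
        (C₁ * (C₂ * (r ^ (n / 2 + β) * A + r ^ (β - α) * H))) := by gcongr
    _ = r ^ lam * A + k * C₁ * C₂ * (r ^ lam * A + r ^ (lam - (n / 2 + α)) * H) := by
        rw [e1, e2]; ring
    _ ≤ (r ^ lam * A + r ^ (lam - (n / 2 + α)) * H) +
        k * C₁ * C₂ * (r ^ lam * A + r ^ (lam - (n / 2 + α)) * H) := by
        gcongr
        exact le_self_add
    _ = _ := by push_cast; ring

theorem stmt5 (d : ℕ) (hd : 1 ≤ d) (lam α : ℝ) (hlam0 : 0 < lam) (hlamd : lam < d)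
    (hα1 : lam < (d : ℝ) / 2 → 0 ≤ α)
    (hα2 : (d : ℝ) / 2 ≤ lam → α > lam - (d : ℝ) / 2) :
    ∃ C : ℝ≥0, 0 < C ∧ ∀ f : EuclideanSpace ℝ (Fin d) → ℂ, Integrable f →
      He d α f ≠ ⊤ →
      ∀ v : EuclideanSpace ℝ (Fin d),
        (∫⁻ w, (‖v - w‖₊ : ℝ≥0∞) ^ (-lam) * (‖f w‖₊ : ℝ≥0∞)) ≤
          C * L1e d f ^ (1 - 2 * lam / ((d : ℝ) + 2 * α)) *
            He d α f ^ (2 * lam / ((d : ℝ) + 2 * α)) := by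
  have hfr : Module.finrank ℝ (EuclideanSpace ℝ (Fin d)) = d := by simp
  have hn : (Module.finrank ℝ (EuclideanSpace ℝ (Fin d)) : ℝ) = d := by rw [hfr]
  obtain ⟨C, hC0, hC⟩ := exists_rieszPotential_le (V := EuclideanSpace ℝ (Fin d)) (α := α)
    (by rw [hfr]; exact hd) hlam0 (by rwa [hn]) (by rwa [hn]) (by rwa [hn])
  refine ⟨C, hC0, fun f hf hfin v ↦ (hC f hf hfin v).trans_eq ?_⟩
  have hθ : lam / ((d : ℝ) / 2 + α) = 2 * lam / ((d : ℝ) + 2 * α) := by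
    rw [← mul_div_mul_left lam _ (two_ne_zero (α := ℝ))]
    ring_nf
  rw [hn, hθ, mul_assoc]
  rfl
end

section
/- Let $d\ge 1$, $0<\lambda<d$, and $\alpha$ as in the fractional-integral lemma ($\alpha\ge 0$ if $\lambda<d/2$, $\alpha>\lambda-d/2$ if $\lambda\ge d/2$). Then there is a constant $C=C(\alpha,\lambda,d)$ such that for all $f\in L^1\cap\dot H^\alpha(\mathbb{R}^d)$, $\sup_{\xi\in\mathbb{R}^d}\int_{\mathbb{R}^d}|\zeta|^{-d+\lambda}\,|\hat f(\xi-\zeta)|\,d\zeta \le C\,\|f\|_{L^1}^{1-\theta}\,\|f\|_{\dot H^\alpha}^{\theta}$ with $\theta=2\lambda/(d+2\alpha)$. -/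
open MeasureTheory FourierTransform ENNReal
open scoped NNReal

theorem enorm_coe_nnreal (R : ℝ≥0) : ‖(R : ℝ)‖ₑ = R := by
  rw [Real.enorm_of_nonneg R.coe_nonneg, ENNReal.ofReal_coe_nnreal]

theorem ennreal_rpow_le_rpow_of_nonpos {a b : ℝ≥0∞} {s : ℝ} (hs : s ≤ 0) (h : a ≤ b) :
    b ^ s ≤ a ^ s := by
  rw [← neg_neg s, ENNReal.rpow_neg, ENNReal.rpow_neg a, ENNReal.inv_le_inv]
  exact ENNReal.rpow_le_rpow h (by linarith)

section PowerWeights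

variable {E : Type*} [NormedAddCommGroup E] [NormedSpace ℝ E] [FiniteDimensional ℝ E]
  [MeasurableSpace E] [BorelSpace E] (μ : Measure E) [μ.IsAddHaarMeasure]

theorem setLIntegral_enorm_rpow_of_preimage_smul {S T : Set E} (hS : MeasurableSet S) (s : ℝ)
    {R : ℝ≥0} (hR : R ≠ 0) (hST : (fun x : E => (R : ℝ) • x) ⁻¹' S = T) :
    ∫⁻ x in S, ‖x‖ₑ ^ s ∂μ =
      (R : ℝ≥0∞) ^ (s + Module.finrank ℝ E) * ∫⁻ x in T, ‖x‖ₑ ^ s ∂μ := by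
  have hR0 : (R : ℝ≥0∞) ≠ 0 := by simpa using hR
  have hRr : (R : ℝ) ≠ 0 := by simpa using hR
  have hmap : ∫⁻ x in T, ‖(R : ℝ) • x‖ₑ ^ s ∂μ =
      (R : ℝ≥0∞) ^ (-(Module.finrank ℝ E : ℝ)) * ∫⁻ x in S, ‖x‖ₑ ^ s ∂μ := by
    rw [← hST, ← setLIntegral_map hS (f := fun x : E => ‖x‖ₑ ^ s) (by fun_prop) (by fun_prop),
      Measure.map_addHaar_smul μ hRr, Measure.restrict_smul, lintegral_smul_measure, smul_eq_mul]
    congr 1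
    rw [abs_of_nonneg (by positivity), ENNReal.ofReal_inv_of_pos (by positivity),
      ENNReal.ofReal_pow R.coe_nonneg, ENNReal.ofReal_coe_nnreal, ENNReal.rpow_neg, ENNReal.rpow_natCast]
  have hhom : ∫⁻ x in T, ‖(R : ℝ) • x‖ₑ ^ s ∂μ = (R : ℝ≥0∞) ^ s * ∫⁻ x in T, ‖x‖ₑ ^ s ∂μ := by
    rw [← lintegral_const_mul _ (by fun_prop)]
    congr with x
    rw [enorm_smul, enorm_coe_nnreal]
    rcases eq_or_ne x 0 with rfl | hx
    · rcases lt_trichotomy s 0 with hs | rfl | hs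
      · simp only [enorm_zero, mul_zero, ENNReal.zero_rpow_of_neg hs]
        rw [ENNReal.mul_top]
        exact (ENNReal.rpow_pos (pos_iff_ne_zero.2 hR0) coe_ne_top).ne'
      · simp
      · simp [ENNReal.zero_rpow_of_pos hs]
    · exact ENNReal.mul_rpow_of_ne_zero hR0 (by simpa using hx) s
  rw [add_comm, ENNReal.rpow_add _ _ hR0 coe_ne_top, mul_assoc, ← hhom, hmap, ← mul_assoc,
    ← ENNReal.rpow_add _ _ hR0 coe_ne_top]
  simp

theorem setLIntegral_enorm_rpow_lt (s : ℝ) {R : ℝ≥0} (hR : R ≠ 0) :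
    ∫⁻ x in {x : E | ‖x‖ₑ < R}, ‖x‖ₑ ^ s ∂μ =
      (R : ℝ≥0∞) ^ (s + Module.finrank ℝ E) * ∫⁻ x in {x : E | ‖x‖ₑ < 1}, ‖x‖ₑ ^ s ∂μ := by
  refine setLIntegral_enorm_rpow_of_preimage_smul μ
    (measurableSet_lt (by fun_prop) (by fun_prop)) s hR ?_
  ext x
  simp only [Set.mem_preimage, Set.mem_ofPred_eq, enorm_smul, enorm_coe_nnreal]
  nth_rewrite 2 [← mul_one (R : ℝ≥0∞)]
  rw [ENNReal.mul_lt_mul_iff_right (by simpa using hR) coe_ne_top]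

theorem setLIntegral_enorm_rpow_ge (s : ℝ) {R : ℝ≥0} (hR : R ≠ 0) :
    ∫⁻ x in {x : E | R ≤ ‖x‖ₑ}, ‖x‖ₑ ^ s ∂μ =
      (R : ℝ≥0∞) ^ (s + Module.finrank ℝ E) * ∫⁻ x in {x : E | 1 ≤ ‖x‖ₑ}, ‖x‖ₑ ^ s ∂μ := by
  refine setLIntegral_enorm_rpow_of_preimage_smul μ
    (measurableSet_le (by fun_prop) (by fun_prop)) s hR ?_
  ext x
  simp only [Set.mem_preimage, Set.mem_ofPred_eq, enorm_smul, enorm_coe_nnreal]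
  nth_rewrite 1 [← mul_one (R : ℝ≥0∞)]
  rw [ENNReal.mul_le_mul_iff_right (by simpa using hR) coe_ne_top]

theorem setLIntegral_enorm_rpow_lt_one_ne_top [Nontrivial E] {s : ℝ}
    (hs : -(Module.finrank ℝ E : ℝ) < s) :
    ∫⁻ x in {x : E | ‖x‖ₑ < 1}, ‖x‖ₑ ^ s ∂μ ≠ ⊤ := by
  have hball : {x : E | ‖x‖ₑ < 1} = Metric.ball 0 1 := by
    ext x
    rw [Set.mem_ofPred_eq, mem_ball_zero_iff, ← ofReal_norm, ENNReal.ofReal_lt_one]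
  have hint : IntegrableOn (fun x : E => ‖x‖ ^ s) (Metric.ball 0 1) μ := by
    refine integrableOn_ball_of_norm_le_rpow (C := 1) (α := -s) Module.finrank_pos
      (by linarith) (Filter.Eventually.of_forall fun x => ?_)
      (Measurable.aestronglyMeasurable (by fun_prop))
    rw [neg_neg, one_mul, Real.norm_of_nonneg (by positivity)]
  rw [hball]
  refine (lt_of_le_of_lt (le_of_eq (lintegral_congr_ae ?_)) hint.2).ne
  filter_upwards [ae_restrict_of_ae (Measure.ae_ne μ (0 : E))] with x hx
  rw [Real.enorm_of_nonneg (by positivity), ← ENNReal.ofReal_rpow_of_pos (norm_pos_iff.2 hx),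
    ofReal_norm]

theorem setLIntegral_enorm_rpow_one_le_ne_top {s : ℝ}
    (hs : s < -(Module.finrank ℝ E : ℝ)) :
    ∫⁻ x in {x : E | 1 ≤ ‖x‖ₑ}, ‖x‖ₑ ^ s ∂μ ≠ ⊤ := by
  have hs0 : s ≤ 0 := by
    have : (0 : ℝ) ≤ Module.finrank ℝ E := by positivity
    linarith
  have hfin := finite_integral_one_add_norm (μ := μ) (r := -s) (by linarith)
  refine (lt_of_le_of_lt ?_
    (ENNReal.mul_lt_top (ENNReal.ofReal_lt_top (r := 2 ^ (-s))) hfin)).ne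
  rw [← lintegral_const_mul _ (by fun_prop)]
  refine le_trans (setLIntegral_mono' (measurableSet_le (by fun_prop) (by fun_prop)) ?_)
    (setLIntegral_le_lintegral _ _)
  intro x hx
  have hx1 : 1 ≤ ‖x‖ := by
    rwa [Set.mem_ofPred_eq, ← ofReal_norm, ENNReal.one_le_ofReal] at hx
  rw [← ofReal_norm, ENNReal.ofReal_rpow_of_pos (by linarith),
    ← ENNReal.ofReal_mul (by positivity), neg_neg]
  refine ENNReal.ofReal_le_ofReal ?_
  calc ‖x‖ ^ s = 2 ^ (-s) * (2 * ‖x‖) ^ s := by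
        rw [Real.mul_rpow (by norm_num) (by positivity), ← mul_assoc, ← Real.rpow_add (by norm_num)]
        simp
    _ ≤ 2 ^ (-s) * (1 + ‖x‖) ^ s := by
        gcongr ?_ * ?_
        exact Real.rpow_le_rpow_of_nonpos (by positivity) (by linarith) hs0

theorem enorm_rpow_mul_rpow_sq_le {a b : ℝ≥0∞} (ha : a ≠ 0) (ha' : a ≠ ⊤) (hb : b ≠ 0)
    (hb' : b ≠ ⊤) {s t : ℝ} (hs : s ≤ 0) (ht : t ≤ 0) :
    (a ^ s * b ^ t) ^ (2 : ℝ) ≤ a ^ (2 * s + 2 * t) + b ^ (2 * s + 2 * t) := by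
  rw [ENNReal.mul_rpow_of_nonneg _ _ zero_le_two, ← ENNReal.rpow_mul, ← ENNReal.rpow_mul,
    ENNReal.rpow_add _ _ ha ha', ENNReal.rpow_add _ _ hb hb', mul_comm s, mul_comm t]
  rcases le_total a b with h | h
  · exact le_add_right (mul_le_mul_right (ennreal_rpow_le_rpow_of_nonpos (by linarith) h) _)
  · exact le_add_left (mul_le_mul_left (ennreal_rpow_le_rpow_of_nonpos (by linarith) h) _)

theorem lintegral_enorm_rpow_mul_le {s α : ℝ} (hs : s ≤ 0) (hα : 0 ≤ α)
    {g : E → ℝ≥0∞} (hg : Measurable g) {A : ℝ≥0∞} (hA : ∀ x, g x ≤ A) (ξ : E)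
    {R : ℝ≥0} (hR : R ≠ 0) :
    ∫⁻ ζ, ‖ζ‖ₑ ^ s * g (ξ - ζ) ∂μ ≤
      2 * (∫⁻ x in {x : E | ‖x‖ₑ < R}, ‖x‖ₑ ^ s ∂μ) * A +
      (2 * ∫⁻ x in {x : E | R ≤ ‖x‖ₑ}, ‖x‖ₑ ^ (2 * s + 2 * -α) ∂μ) ^ (1 / 2 : ℝ) *
        (∫⁻ x, ‖x‖ₑ ^ (2 * α) * g x ^ (2 : ℝ) ∂μ) ^ (1 / 2 : ℝ) := by
  have hR0 : (R : ℝ≥0∞) ≠ 0 := by simpa using hR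
  have htrans (S : Set E) (hS : MeasurableSet S) (F : E → ℝ≥0∞) :
      ∫⁻ ζ in {ζ | ξ - ζ ∈ S}, F (ξ - ζ) ∂μ = ∫⁻ x in S, F x ∂μ := by
    have hS' : MeasurableSet {ζ : E | ξ - ζ ∈ S} := hS.preimage (by fun_prop)
    rw [← lintegral_indicator hS', ← lintegral_indicator hS,
      ← lintegral_sub_left_eq_self (S.indicator F) ξ]
    rfl
  set S₁ : Set E := {x : E | ‖x‖ₑ < R}
  set S₂ : Set E := {x : E | R ≤ ‖x‖ₑ}
  have hS₁ : MeasurableSet S₁ := measurableSet_lt (by fun_prop) (by fun_prop)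
  have hS₂ : MeasurableSet S₂ := measurableSet_le (by fun_prop) (by fun_prop)
  set U : Set E := {ζ | ξ - ζ ∈ S₁} ∩ S₂
  set V : Set E := {ζ | ξ - ζ ∈ S₂} ∩ S₂
  have hS₁' : MeasurableSet {ζ : E | ξ - ζ ∈ S₁} := hS₁.preimage (by fun_prop)
  have hS₂' : MeasurableSet {ζ : E | ξ - ζ ∈ S₂} := hS₂.preimage (by fun_prop)
  have hU : MeasurableSet U := hS₁'.inter hS₂
  have hV : MeasurableSet V := hS₂'.inter hS₂
  have hcover : (Set.univ : Set E) ⊆ (S₁ ∪ U) ∪ V := by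
    intro ζ _
    rcases lt_or_ge ‖ζ‖ₑ R with h | h
    · exact Or.inl (Or.inl h)
    · rcases lt_or_ge ‖ξ - ζ‖ₑ R with h' | h'
      · exact Or.inl (Or.inr ⟨h', h⟩)
      · exact Or.inr ⟨h', h⟩
  have hsplit : ∫⁻ ζ, ‖ζ‖ₑ ^ s * g (ξ - ζ) ∂μ ≤
      (∫⁻ ζ in S₁, ‖ζ‖ₑ ^ s * g (ξ - ζ) ∂μ + ∫⁻ ζ in U, ‖ζ‖ₑ ^ s * g (ξ - ζ) ∂μ) +
        ∫⁻ ζ in V, ‖ζ‖ₑ ^ s * g (ξ - ζ) ∂μ := by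
    rw [← setLIntegral_univ]
    exact (lintegral_mono_set hcover).trans
      ((lintegral_union_le _ _ _).trans (add_le_add_left (lintegral_union_le _ _ _) _))
  have hnear : ∫⁻ ζ in S₁, ‖ζ‖ₑ ^ s * g (ξ - ζ) ∂μ ≤ (∫⁻ x in S₁, ‖x‖ₑ ^ s ∂μ) * A := by
    rw [← lintegral_mul_const _ (by fun_prop)]
    exact lintegral_mono fun ζ => mul_le_mul_right (hA _) _
  have hnear' : ∫⁻ ζ in U, ‖ζ‖ₑ ^ s * g (ξ - ζ) ∂μ ≤ (∫⁻ x in S₁, ‖x‖ₑ ^ s ∂μ) * A := by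
    rw [← htrans S₁ hS₁, ← lintegral_mul_const _ (by fun_prop)]
    refine le_trans (setLIntegral_mono' hU ?_) (lintegral_mono_set Set.inter_subset_left)
    intro ζ hζ
    exact mul_le_mul' (ennreal_rpow_le_rpow_of_nonpos hs (hζ.1.le.trans hζ.2)) (hA _)
  have hfar : ∫⁻ ζ in V, ‖ζ‖ₑ ^ s * g (ξ - ζ) ∂μ ≤
      (2 * ∫⁻ x in S₂, ‖x‖ₑ ^ (2 * s + 2 * -α) ∂μ) ^ (1 / 2 : ℝ) *
        (∫⁻ x, ‖x‖ₑ ^ (2 * α) * g x ^ (2 : ℝ) ∂μ) ^ (1 / 2 : ℝ) := by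
    have hne (x : E) (hx : x ∈ S₂) : ‖x‖ₑ ≠ 0 :=
      ((pos_iff_ne_zero.2 hR0).trans_le hx).ne'
    have hfactor : ∫⁻ ζ in V, ‖ζ‖ₑ ^ s * g (ξ - ζ) ∂μ =
        ∫⁻ ζ in V, ((fun ζ => ‖ζ‖ₑ ^ s * ‖ξ - ζ‖ₑ ^ (-α)) *
          fun ζ => ‖ξ - ζ‖ₑ ^ α * g (ξ - ζ)) ζ ∂μ := by
      refine setLIntegral_congr_fun hV fun ζ hζ => ?_
      simp only [Pi.mul_apply]
      rw [mul_assoc, ← mul_assoc (‖ξ - ζ‖ₑ ^ (-α)),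
        ← ENNReal.rpow_add _ _ (hne _ hζ.1) enorm_ne_top]
      simp
    rw [hfactor]
    refine (ENNReal.lintegral_mul_le_Lp_mul_Lq _ Real.HolderConjugate.two_two
      (by fun_prop) (by fun_prop)).trans (mul_le_mul' ?_ ?_)
    · refine ENNReal.rpow_le_rpow ?_ (by norm_num)
      calc ∫⁻ ζ in V, (‖ζ‖ₑ ^ s * ‖ξ - ζ‖ₑ ^ (-α)) ^ (2 : ℝ) ∂μ
          ≤ ∫⁻ ζ in V, (‖ζ‖ₑ ^ (2 * s + 2 * -α) + ‖ξ - ζ‖ₑ ^ (2 * s + 2 * -α)) ∂μ :=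
            setLIntegral_mono' hV fun ζ hζ => enorm_rpow_mul_rpow_sq_le (hne _ hζ.2)
              enorm_ne_top (hne _ hζ.1) enorm_ne_top hs (by linarith)
        _ = ∫⁻ ζ in V, ‖ζ‖ₑ ^ (2 * s + 2 * -α) ∂μ +
              ∫⁻ ζ in V, ‖ξ - ζ‖ₑ ^ (2 * s + 2 * -α) ∂μ :=
            lintegral_add_left (by fun_prop) _
        _ ≤ ∫⁻ x in S₂, ‖x‖ₑ ^ (2 * s + 2 * -α) ∂μ +
              ∫⁻ ζ in {ζ | ξ - ζ ∈ S₂}, ‖ξ - ζ‖ₑ ^ (2 * s + 2 * -α) ∂μ :=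
            add_le_add (lintegral_mono_set Set.inter_subset_right)
              (lintegral_mono_set Set.inter_subset_left)
        _ = 2 * ∫⁻ x in S₂, ‖x‖ₑ ^ (2 * s + 2 * -α) ∂μ := by
            rw [htrans S₂ hS₂ fun x => ‖x‖ₑ ^ (2 * s + 2 * -α), ← two_mul]
    · refine ENNReal.rpow_le_rpow ?_ (by norm_num)
      rw [← lintegral_sub_left_eq_self (μ := μ) (fun x => ‖x‖ₑ ^ (2 * α) * g x ^ (2 : ℝ)) ξ]
      refine (setLIntegral_le_lintegral _ _).trans (lintegral_mono fun ζ => le_of_eq ?_)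
      simp only
      rw [ENNReal.mul_rpow_of_nonneg _ _ zero_le_two, ← ENNReal.rpow_mul, mul_comm α]
  refine hsplit.trans (add_le_add ((add_le_add hnear hnear').trans (le_of_eq ?_)) hfar)
  ring

end PowerWeights

theorem enorm_fourier_le_L1e {d : ℕ} {f : EuclideanSpace ℝ (Fin d) → ℂ}
    (x : EuclideanSpace ℝ (Fin d)) : ‖𝓕 f x‖ₑ ≤ L1e d f := by
  rw [Real.fourier_eq]
  refine (enorm_integral_le_lintegral_enorm _).trans (lintegral_mono fun v => le_of_eq ?_)
  rw [← ofReal_norm, Circle.norm_smul, ofReal_norm]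
  rfl

theorem measurable_fourier {d : ℕ} {f : EuclideanSpace ℝ (Fin d) → ℂ} (hf : Integrable f) :
    Measurable (𝓕 f) :=
  (VectorFourier.fourierIntegral_continuous Real.continuous_fourierChar
    continuous_inner hf).measurable

theorem lintegral_enorm_rpow_mul_fourier_eq_zero {d : ℕ} {f : EuclideanSpace ℝ (Fin d) → ℂ}
    (s : ℝ) (h0 : 𝓕 f =ᵐ[volume] 0) (ξ : EuclideanSpace ℝ (Fin d)) :
    ∫⁻ ζ, ‖ζ‖ₑ ^ s * ‖𝓕 f (ξ - ζ)‖ₑ = 0 := by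
  rw [lintegral_congr_ae (g := 0), Pi.zero_def, lintegral_zero]
  filter_upwards [(Measure.measurePreserving_sub_left volume ξ).quasiMeasurePreserving.ae h0] with ζ hζ
  rw [hζ]
  simp

theorem fourier_ae_eq_zero_of_He_eq_zero {d : ℕ} (hd : 1 ≤ d) {α : ℝ}
    {f : EuclideanSpace ℝ (Fin d) → ℂ} (hf : Integrable f) (h : He d α f = 0) :
    𝓕 f =ᵐ[volume] 0 := by
  have : Nontrivial (EuclideanSpace ℝ (Fin d)) :=
    Module.nontrivial_of_finrank_pos (R := ℝ) (by rw [finrank_euclideanSpace_fin]; omega)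
  have hF := measurable_fourier hf
  have hint : ∫⁻ ξ, ‖ξ‖ₑ ^ (2 * α) * ‖𝓕 f ξ‖ₑ ^ (2 : ℝ) = 0 :=
    (ENNReal.rpow_eq_zero_iff_of_pos (by norm_num)).1 h
  rw [lintegral_eq_zero_iff (by fun_prop)] at hint
  filter_upwards [hint, Measure.ae_ne volume 0] with x hx hx0
  have hpos : ‖x‖ₑ ^ (2 * α) ≠ 0 :=
    (ENNReal.rpow_pos (by simpa using hx0) enorm_ne_top).ne'
  simpa [hpos] using hx

theorem stmt6 (d : ℕ) (hd : 1 ≤ d) (lam α : ℝ) (hlam0 : 0 < lam) (hlamd : lam < d)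
    (hα1 : lam < (d : ℝ) / 2 → 0 ≤ α)
    (hα2 : (d : ℝ) / 2 ≤ lam → α > lam - (d : ℝ) / 2) :
    ∃ C : ℝ≥0, 0 < C ∧ ∀ f : EuclideanSpace ℝ (Fin d) → ℂ, Integrable f →
      He d α f ≠ ⊤ →
      ∀ ξ : EuclideanSpace ℝ (Fin d),
        (∫⁻ ζ, (‖ζ‖₊ : ℝ≥0∞) ^ (-(d : ℝ) + lam) * (‖𝓕 f (ξ - ζ)‖₊ : ℝ≥0∞)) ≤
          C * L1e d f ^ (1 - 2 * lam / ((d : ℝ) + 2 * α)) *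
            He d α f ^ (2 * lam / ((d : ℝ) + 2 * α)) := by
  have hα : 0 ≤ α := by
    rcases lt_or_ge lam ((d : ℝ) / 2) with h | h
    · exact hα1 h
    · linarith [hα2 h]
  have hd0 : (0 : ℝ) < d := by exact_mod_cast hd
  have hp : 2 * lam < d + 2 * α := by
    rcases lt_or_ge lam ((d : ℝ) / 2) with h | h
    · linarith
    · linarith [hα2 h]
  have : Nontrivial (EuclideanSpace ℝ (Fin d)) :=
    Module.nontrivial_of_finrank_pos (R := ℝ) (by rw [finrank_euclideanSpace_fin]; omega)
  have hc₁ := setLIntegral_enorm_rpow_lt_one_ne_top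
    (volume : Measure (EuclideanSpace ℝ (Fin d))) (s := -(d : ℝ) + lam) (by simpa using hlam0)
  have hc₂ := setLIntegral_enorm_rpow_one_le_ne_top
    (volume : Measure (EuclideanSpace ℝ (Fin d))) (s := 2 * (-(d : ℝ) + lam) + 2 * -α)
    (by rw [finrank_euclideanSpace_fin]; linarith)
  have hscale₁ := fun R : ℝ≥0 => setLIntegral_enorm_rpow_lt (R := R)
    (volume : Measure (EuclideanSpace ℝ (Fin d))) (-(d : ℝ) + lam)
  have hscale₂ := fun R : ℝ≥0 => setLIntegral_enorm_rpow_ge (R := R)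
    (volume : Measure (EuclideanSpace ℝ (Fin d))) (2 * (-(d : ℝ) + lam) + 2 * -α)
  generalize (∫⁻ x in {x : EuclideanSpace ℝ (Fin d) | ‖x‖ₑ < 1}, ‖x‖ₑ ^ (-(d : ℝ) + lam)) = c₁
    at hc₁ hscale₁
  generalize (∫⁻ x in {x : EuclideanSpace ℝ (Fin d) | 1 ≤ ‖x‖ₑ},
    ‖x‖ₑ ^ (2 * (-(d : ℝ) + lam) + 2 * -α)) = c₂ at hc₂ hscale₂
  lift c₁ to ℝ≥0 using hc₁
  lift c₂ to ℝ≥0 using hc₂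
  refine ⟨2 * c₁ + (2 * c₂) ^ (1 / 2 : ℝ) + 1, by positivity, fun f hf hB ξ => ?_⟩
  change ∫⁻ ζ, ‖ζ‖ₑ ^ (-(d : ℝ) + lam) * ‖𝓕 f (ξ - ζ)‖ₑ ≤ _
  have hF := measurable_fourier hf
  by_cases hA0 : L1e d f = 0
  · rw [lintegral_enorm_rpow_mul_fourier_eq_zero _ (.of_forall fun x => ?_)]
    · exact zero_le
    · simpa [hA0] using enorm_fourier_le_L1e (f := f) x
  by_cases hB0 : He d α f = 0
  · rw [lintegral_enorm_rpow_mul_fourier_eq_zero _ (fourier_ae_eq_zero_of_He_eq_zero hd hf hB0)]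
    exact zero_le
  have hA : L1e d f ≠ ⊤ := hf.2.ne
  have hkey := fun R : ℝ≥0 => lintegral_enorm_rpow_mul_le (R := R) volume
    (s := -(d : ℝ) + lam) (by linarith) hα hF.enorm enorm_fourier_le_L1e ξ
  change ∀ R : ℝ≥0, R ≠ 0 → _ ≤ _ + _ * He d α f at hkey
  set A := L1e d f
  set B := He d α f
  set θ := 2 * lam / ((d : ℝ) + 2 * α) with hθ
  have hq0 : B / A ≠ 0 := (ENNReal.div_pos hB0 hA).ne'
  have hq : B / A ≠ ⊤ := ENNReal.div_ne_top hB hA0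
  obtain ⟨R, hR⟩ : ∃ R : ℝ≥0, (R : ℝ≥0∞) = (B / A) ^ (2 / ((d : ℝ) + 2 * α)) :=
    ⟨_, ENNReal.coe_toNNReal (ENNReal.rpow_ne_top_of_ne_zero hq0 hq)⟩
  have hR0 : R ≠ 0 := by
    rw [← ENNReal.coe_ne_zero, hR]
    exact (ENNReal.rpow_pos (pos_iff_ne_zero.2 hq0) hq).ne'
  have hden : (d : ℝ) + 2 * α ≠ 0 := by positivity
  have hnear : (R : ℝ≥0∞) ^ (-(d : ℝ) + lam + d) * A = A ^ (1 - θ) * B ^ θ := by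
    rw [hR, ← ENNReal.rpow_mul, show 2 / ((d : ℝ) + 2 * α) * (-(d : ℝ) + lam + d) = θ by
      rw [hθ]; ring, div_eq_mul_inv, ENNReal.mul_rpow_of_ne_top hB (ENNReal.inv_ne_top.2 hA0),
      ENNReal.inv_rpow, ← ENNReal.rpow_neg, sub_eq_add_neg, ENNReal.rpow_add _ _ hA0 hA,
      ENNReal.rpow_one]
    ring
  have hfar : ((R : ℝ≥0∞) ^ (2 * (-(d : ℝ) + lam) + 2 * -α + d)) ^ (1 / 2 : ℝ) * B =
      A ^ (1 - θ) * B ^ θ := by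
    rw [hR, ← ENNReal.rpow_mul, ← ENNReal.rpow_mul,
      show 2 / ((d : ℝ) + 2 * α) * ((2 * (-(d : ℝ) + lam) + 2 * -α + d) * (1 / 2)) = θ - 1 by
      rw [hθ]; field_simp; ring, div_eq_mul_inv,
      ENNReal.mul_rpow_of_ne_zero hB0 (ENNReal.inv_ne_zero.2 hA),
      ENNReal.inv_rpow, ← ENNReal.rpow_neg, neg_sub, ENNReal.rpow_sub _ _ hB0 hB,
      ENNReal.rpow_one, mul_right_comm, ENNReal.div_mul_cancel hB0 hB, mul_comm]
  refine (hkey R hR0).trans ?_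
  rw [hscale₁ R hR0, hscale₂ R hR0, finrank_euclideanSpace_fin,
    mul_left_comm 2 ((R : ℝ≥0∞) ^ (2 * (-(d : ℝ) + lam) + 2 * -α + d)),
    ENNReal.mul_rpow_of_nonneg _ _ (by norm_num : (0 : ℝ) ≤ 1 / 2)]
  calc _ = 2 * c₁ * ((R : ℝ≥0∞) ^ (-(d : ℝ) + lam + d) * A) + (2 * c₂) ^ (1 / 2 : ℝ) *
        (((R : ℝ≥0∞) ^ (2 * (-(d : ℝ) + lam) + 2 * -α + d)) ^ (1 / 2 : ℝ) * B) := by ring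
    _ = (2 * c₁ + (2 * c₂) ^ (1 / 2 : ℝ)) * (A ^ (1 - θ) * B ^ θ) := by
        rw [hnear, hfar]; ring
    _ ≤ (2 * c₁ + (2 * c₂) ^ (1 / 2 : ℝ) + 1) * (A ^ (1 - θ) * B ^ θ) :=
        mul_le_mul_left le_self_add _
    _ = _ := by
        push_cast [ENNReal.coe_rpow_of_nonneg _ (by norm_num : (0 : ℝ) ≤ 1 / 2)]
        ring
end

section
/- Let $d\ge 1$, $B(v,v_*,\sigma)=|v-v_*|^{-\lambda}b(\mathbf{k}\cdot\sigma)$ with $b\in L^1(\mathbb{S}^{d-1})$ nonnegative and $0<\lambda<d$, and let $\alpha$ satisfy $\alpha\ge 0$ for $\lambda<d/2$ and $\alpha>\lambda-d/2$ for $\lambda\ge d/2$. Then for all $f,g\in L^1\cap\dot H^\alpha(\mathbb{R}^d)$, $\|Q(f,g)\|_{L^1} \le 2\,C_J\,\|b\|_{L^1(\mathbb{S}^{d-1})}\,\|f\|_{L^1}^{1-\theta}\|f\|_{\dot H^\alpha}^{\theta}\,\|g\|_{L^1}$ with $\theta=2\lambda/(d+2\alpha)$, where $C_J$ is the constant from the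 uniform fractional integral bound. -/
open MeasureTheory FourierTransform ENNReal
open scoped NNReal

open scoped RealInnerProductSpace

/-- Surface measure on the unit sphere in ℝ^d. -/
noncomputable def sph (d : ℕ) : Measure (EuclideanSpace ℝ (Fin d)) :=
  (μH[(d : ℝ) - 1]).restrict (Metric.sphere 0 1)

/-- The Boltzmann collision operator with kernel |v-v_*|^{-λ} b(k·σ). -/
noncomputable def Qop (d : ℕ) (lam : ℝ) (b : ℝ → ℝ)
    (f g : EuclideanSpace ℝ (Fin d) → ℂ) (v : EuclideanSpace ℝ (Fin d)) : ℂ :=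
  ∫ w, ∫ σ, ((‖v - w‖ ^ (-lam) * b ⟪‖v - w‖⁻¹ • (v - w), σ⟫ : ℝ) : ℂ) *
      (f ((2 : ℝ)⁻¹ • (v + w) + (‖v - w‖ / 2) • σ) *
          g ((2 : ℝ)⁻¹ • (v + w) - (‖v - w‖ / 2) • σ) -
        f v * g w) ∂sph d

/-- The L¹ norm of the angular kernel b over the sphere, computed with deviation
direction k. -/
noncomputable def bL1 (d : ℕ) (b : ℝ → ℝ) (k : EuclideanSpace ℝ (Fin d)) : ℝ≥0∞ :=
  ∫⁻ σ, ENNReal.ofReal (b ⟪k, σ⟫) ∂sph d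

theorem hausdorffMeasure_sphere_lt_top {E : Type*} [NormedAddCommGroup E] [InnerProductSpace ℝ E]
    [FiniteDimensional ℝ E] [MeasurableSpace E] [BorelSpace E] {n : ℕ}
    (hn : Module.finrank ℝ E = n + 1) :
    μH[(n : ℝ)] (Metric.sphere (0 : E) 1) < ⊤ := by
  refine (isCompact_sphere (0 : E) 1).measure_lt_top_of_nhdsWithin fun x hx ↦ ?_
  have hx1 : ‖-x‖ = 1 := by simpa using hx
  set F := (ℝ ∙ (-x))ᗮ
  have hF : Module.finrank ℝ F = n := by
    have : Fact (Module.finrank ℝ E = n + 1) := ⟨hn⟩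
    exact Submodule.finrank_orthogonal_span_singleton (norm_ne_zero_iff.1 (by simp [hx1]))
  have hsm : ContDiff ℝ 1 (fun w : F ↦ stereoInvFunAux (-x) (w : E)) :=
    contDiff_stereoInvFunAux.comp F.subtypeL.contDiff
  obtain ⟨K, t, ht, hK⟩ := (hsm.contDiffAt (x := 0)).exists_lipschitzOnWith
  have hfin : μH[(n : ℝ)] ((fun w : F ↦ stereoInvFunAux (-x) (w : E)) '' (t ∩ Metric.ball 0 1))
      < ⊤ := by
    refine ((hK.mono Set.inter_subset_left).hausdorffMeasure_image_le
      (Nat.cast_nonneg n)).trans_lt ?_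
    refine ENNReal.mul_lt_top (by finiteness) ?_
    have : (μH[(n : ℝ)] : Measure F).IsAddHaarMeasure := hF ▸ isAddHaarMeasure_hausdorffMeasure
    exact (measure_mono Set.inter_subset_right).trans_lt measure_ball_lt_top
  refine ⟨_, ?_, hfin⟩
  have hxx : innerSL ℝ (-x) x = -1 := by
    rw [innerSL_apply_apply, inner_neg_left, real_inner_self_eq_norm_sq]
    simp_all
  have hmem : x ∈ {y : E | innerSL ℝ (-x) y ≠ (1 : ℝ)} := by
    rw [Set.mem_ofPred_eq, hxx]; norm_num
  have hopen : IsOpen {y : E | innerSL ℝ (-x) y ≠ (1 : ℝ)} :=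
    isOpen_ne_fun (innerSL ℝ (-x)).continuous continuous_const
  have hcont : ContinuousAt (stereoToFun (-x)) x :=
    continuousOn_stereoToFun.continuousAt (hopen.mem_nhds hmem)
  have h0 : stereoToFun (-x) x = 0 := by
    rw [stereoToFun_apply]
    have : F.orthogonalProjectionOnto (-x) = 0 :=
      Submodule.orthogonalProjectionOnto_orthogonalComplement_singleton_eq_zero (-x)
    rw [map_neg, neg_eq_zero] at this
    rw [this, smul_zero]
  have hpre : ∀ᶠ y in nhds x, stereoToFun (-x) y ∈ t ∩ Metric.ball 0 1 := by
    refine hcont ?_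
    rw [h0]
    exact Filter.inter_mem ht (Metric.ball_mem_nhds _ one_pos)
  filter_upwards [nhdsWithin_le_nhds hpre, nhdsWithin_le_nhds (hopen.mem_nhds hmem),
    self_mem_nhdsWithin] with y hy hy' hys
  refine ⟨_, hy, ?_⟩
  have hne : y ≠ -x := by
    rintro rfl
    exact hy' (by rw [map_neg, hxx, neg_neg])
  exact congrArg Subtype.val (stereo_left_inv hx1 (x := ⟨y, hys⟩) hne)

theorem measure_isOpen_mul_le_of_uniform {X : Type*} [MetricSpace X] [SecondCountableTopology X]
    [MeasurableSpace X] [BorelSpace X] {μ τ : Measure X} [IsFiniteMeasure μ] [IsFiniteMeasure τ]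
    (hμ : ∀ x y r, μ (Metric.ball x r) = μ (Metric.ball y r))
    (hτ : ∀ x y r, τ (Metric.ball x r) = τ (Metric.ball y r)) {U : Set X} (hU : IsOpen U) :
    τ U * μ Set.univ ≤ τ Set.univ * μ U := by
  rcases eq_or_ne μ 0 with rfl | hμ0
  · simp
  obtain ⟨x₀⟩ : Nonempty X := by
    by_contra h
    rw [not_nonempty_iff] at h
    exact hμ0 (Measure.eq_zero_of_isEmpty μ)
  have hpos : ∀ r > 0, μ (Metric.ball x₀ r) ≠ 0 := by
    intro r hr h
    refine hμ0 (Measure.measure_univ_eq_zero.1 (measure_null_of_locally_null _ fun x _ ↦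
      ⟨Metric.ball x r, mem_nhdsWithin_of_mem_nhds (Metric.ball_mem_nhds x hr), ?_⟩))
    rw [hμ x x₀, h]
  have hmeas : ∀ V : Set X, IsOpen V → ∀ r : ℝ,
      MeasurableSet {p : X × X | p.2 ∈ V ∧ dist p.2 p.1 < r} := fun V hV r ↦
    ((hV.preimage continuous_snd).inter
      (isOpen_lt (continuous_snd.dist continuous_fst) continuous_const)).measurableSet
  have hfub : ∀ V : Set X, IsOpen V → ∀ r : ℝ,
      ∫⁻ x, μ (V ∩ Metric.ball x r) ∂τ = τ (Metric.ball x₀ r) * μ V := by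
    intro V hV r
    have h1 := Measure.prod_apply (μ := τ) (ν := μ) (hmeas V hV r)
    have h2 := Measure.prod_apply_symm (μ := τ) (ν := μ) (hmeas V hV r)
    rw [h1] at h2
    refine Eq.trans ?_ (h2.trans ?_)
    · rfl
    · rw [← lintegral_indicator_const hV.measurableSet]
      refine lintegral_congr fun y ↦ ?_
      by_cases hy : y ∈ V
      · rw [Set.indicator_of_mem hy, hτ x₀ y]
        congr 1
        ext z
        simp [hy, dist_comm y z]
      · simp [hy]
  have hstep : ∀ r > 0, τ {x | Metric.ball x r ⊆ U} * μ Set.univ ≤ τ Set.univ * μ U := by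
    intro r hr
    have h1 : μ (Metric.ball x₀ r) * τ {x | Metric.ball x r ⊆ U} ≤
        τ (Metric.ball x₀ r) * μ U := by
      rw [← hfub U hU r]
      refine le_trans ?_ (mul_meas_ge_le_lintegral
        (measurable_measure_prodMk_left (hmeas U hU r)) (μ (Metric.ball x₀ r)))
      gcongr with x
      intro hx
      change _ ≤ μ (U ∩ Metric.ball x r)
      rw [Set.inter_eq_right.2 hx, hμ x₀ x]
    have h2 : μ (Metric.ball x₀ r) * τ Set.univ = τ (Metric.ball x₀ r) * μ Set.univ := by
      rw [← hfub Set.univ isOpen_univ r, ← lintegral_const]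
      refine lintegral_congr fun x ↦ ?_
      rw [Set.univ_inter, hμ x₀ x]
    rw [← ENNReal.mul_le_mul_iff_right (hpos r hr) (measure_ne_top _ _)]
    calc μ (Metric.ball x₀ r) * (τ {x | Metric.ball x r ⊆ U} * μ Set.univ)
        = μ (Metric.ball x₀ r) * τ {x | Metric.ball x r ⊆ U} * μ Set.univ := by ring
      _ ≤ τ (Metric.ball x₀ r) * μ U * μ Set.univ := by gcongr
      _ = τ (Metric.ball x₀ r) * μ Set.univ * μ U := by ring
      _ = μ (Metric.ball x₀ r) * (τ Set.univ * μ U) := by rw [← h2]; ring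
  have hcov : U = ⋃ n : ℕ, {x | Metric.ball x (1 / ((n : ℝ) + 1)) ⊆ U} := by
    ext x
    simp only [Set.mem_iUnion, Set.mem_ofPred_eq]
    constructor
    · intro hx
      obtain ⟨ε, hε, h⟩ := Metric.isOpen_iff.1 hU x hx
      obtain ⟨n, hn⟩ := exists_nat_one_div_lt hε
      exact ⟨n, (Metric.ball_subset_ball hn.le).trans h⟩
    · rintro ⟨n, hn⟩
      exact hn (Metric.mem_ball_self (by positivity))
  have hmono : Monotone fun n : ℕ ↦ {x | Metric.ball x (1 / ((n : ℝ) + 1)) ⊆ U} := by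
    intro m n hmn x hx
    refine (Metric.ball_subset_ball ?_).trans hx
    gcongr
  conv_lhs => rw [hcov]
  rw [hmono.measure_iUnion, ENNReal.iSup_mul]
  exact iSup_le fun n ↦ hstep _ (by positivity)

/-- Christensen's lemma for finite measures. -/
theorem measure_univ_smul_eq_of_uniform {X : Type*} [MetricSpace X] [SecondCountableTopology X]
    [MeasurableSpace X] [BorelSpace X] {μ τ : Measure X} [IsFiniteMeasure μ] [IsFiniteMeasure τ]
    (hμ : ∀ x y r, μ (Metric.ball x r) = μ (Metric.ball y r))
    (hτ : ∀ x y r, τ (Metric.ball x r) = τ (Metric.ball y r)) :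
    τ Set.univ • μ = μ Set.univ • τ := by
  have : IsFiniteMeasure (τ Set.univ • μ) := μ.smul_finite (measure_ne_top _ _)
  refine ext_of_generate_finite _ (BorelSpace.measurable_eq (α := X)) isPiSystem_isOpen
    (fun U hU ↦ ?_) (by simp [mul_comm])
  simp only [Measure.smul_apply, smul_eq_mul]
  refine le_antisymm ?_ ?_
  · rw [mul_comm]
    exact measure_isOpen_mul_le_of_uniform hτ hμ hU
  · rw [mul_comm]
    exact measure_isOpen_mul_le_of_uniform hμ hτ hU

theorem exists_measurable_le_forall_ae_le {X : Type*} [TopologicalSpace X] [MeasurableSpace X]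
    [OpensMeasurableSpace X] (ν : Measure ℝ) [IsFiniteMeasure ν] (b : ℝ → ℝ≥0∞) :
    ∃ β : ℝ → ℝ≥0∞, Measurable β ∧ β ≤ b ∧ ∀ (μ : Measure X) [IsFiniteMeasure μ]
      [μ.InnerRegularCompactLTTop] (p : X → ℝ), Continuous p → μ.map p = ν →
      ∀ h : X → ℝ≥0∞, AEMeasurable h μ → h ≤ b ∘ p → h ≤ᵐ[μ] β ∘ p := by
  set c : ℚ → ℝ≥0∞ := fun q ↦ ((q : ℝ).toNNReal : ℝ≥0∞)
  set S : ℚ → Set ℝ := fun q ↦ {t | c q < b t}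
  set M : ℚ → Set ℝ := fun q ↦ toMeasurable ν (S q)ᶜ
  have hM : ∀ q, MeasurableSet (M q) := fun q ↦ measurableSet_toMeasurable _ _
  refine ⟨fun t ↦ ⨆ q, (M q)ᶜ.indicator (fun _ ↦ c q) t, ?_, ?_, ?_⟩
  · exact Measurable.iSup fun q ↦ measurable_const.indicator (hM q).compl
  · intro t
    refine iSup_le fun q ↦ ?_
    by_cases ht : t ∈ M q
    · simp [ht]
    · have hS : t ∈ S q := by
        by_contra hS
        exact ht (subset_toMeasurable ν (S q)ᶜ hS)
      simpa [ht] using hS.le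
  · intro μ _ _ p hp hmap h hh hle
    have key : ∀ q, ∀ᵐ x ∂μ, c q < h x → p x ∉ M q := by
      intro q
      set A : Set X := ({x | c q < hh.mk h x} \ toMeasurable μ {x | h x ≠ hh.mk h x}) ∩ p ⁻¹' M q
      have hA : MeasurableSet A :=
        ((measurableSet_lt measurable_const hh.measurable_mk).diff
          (measurableSet_toMeasurable _ _)).inter (hp.measurable (hM q))
      have hA0 : μ A = 0 := by
        by_contra hne
        obtain ⟨K, hKA, hK, hKpos⟩ := hA.exists_lt_isCompact_of_ne_top (measure_ne_top μ A)
          (pos_iff_ne_zero.2 hne)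
        have hpK : MeasurableSet (p '' K) := (hK.image hp).measurableSet
        have h1 : p '' K ⊆ M q := by
          rintro _ ⟨x, hx, rfl⟩
          exact (hKA hx).2
        have h2 : (S q)ᶜ ∩ p '' K = ∅ := by
          ext t
          simp only [Set.mem_inter_iff, Set.mem_empty_iff_false, iff_false, not_and]
          rintro ht ⟨x, hx, rfl⟩
          refine ht ?_
          obtain ⟨⟨hx1, hx2⟩, -⟩ := hKA hx
          have hx3 : h x = hh.mk h x := by
            by_contra hcon
            exact hx2 (subset_toMeasurable _ _ hcon)
          exact lt_of_lt_of_le (hx3 ▸ hx1) (hle x)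
        have h3 : ν (p '' K) = 0 := by
          rw [← Set.inter_eq_right.2 h1,
            Measure.measure_toMeasurable_inter hpK (measure_ne_top _ _),
            h2, measure_empty]
        rw [← hmap, Measure.map_apply hp.measurable hpK] at h3
        exact hKpos.ne' (measure_mono_null (Set.subset_preimage_image p K) h3)
      have hN : ∀ᵐ x ∂μ, x ∉ toMeasurable μ {x | h x ≠ hh.mk h x} := by
        refine measure_eq_zero_iff_ae_notMem.1 ?_
        rw [measure_toMeasurable]
        exact hh.ae_eq_mk
      filter_upwards [measure_eq_zero_iff_ae_notMem.1 hA0, hN, hh.ae_eq_mk] with x h1 h2 h3 h4 h5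
      exact h1 ⟨⟨h4.trans_eq h3, h2⟩, h5⟩
    filter_upwards [ae_all_iff.2 key] with x hx
    refine le_of_forall_lt fun a ha ↦ ?_
    obtain ⟨q, -, haq, hq⟩ := ENNReal.lt_iff_exists_rat_btwn.1 ha
    refine haq.trans_le (le_iSup_of_le q ?_)
    rw [Set.indicator_of_mem (hx q hq)]

theorem Measurable.comp_uncurry {α X Y Z : Type*} [MeasurableSpace α] [MeasurableSpace X]
    [MeasurableSpace Y] [MeasurableSpace Z] {G : X → Y → Z} (hG : Measurable (Function.uncurry G))
    {f : α → X} {g : α → Y} (hf : Measurable f) (hg : Measurable g) :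
    Measurable fun a ↦ G (f a) (g a) :=
  hG.comp (hf.prodMk hg)

section Isometry

variable {E : Type*} [NormedAddCommGroup E]

theorem subtype_image_ball_sphere (x : Metric.sphere (0 : E) 1) (r : ℝ) :
    Subtype.val '' Metric.ball x r = Metric.ball (x : E) r ∩ Metric.sphere 0 1 := by
  ext z
  simp only [Set.mem_image, Metric.mem_ball, Subtype.exists, Set.mem_inter_iff]
  constructor
  · rintro ⟨a, ha, h, rfl⟩
    exact ⟨h, ha⟩
  · rintro ⟨h, ha⟩
    exact ⟨z, ha, h, rfl⟩

variable [InnerProductSpace ℝ E]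

theorem exists_linearIsometryEquiv_apply_eq {x y : E} (h : ‖x‖ = ‖y‖) :
    ∃ e : E ≃ₗᵢ[ℝ] E, e x = y :=
  ⟨_, Submodule.reflection_sub h⟩

theorem image_ball_inter_sphere (e : E ≃ₗᵢ[ℝ] E) (x : E) (r : ℝ) :
    e '' (Metric.ball x r ∩ Metric.sphere 0 1) = Metric.ball (e x) r ∩ Metric.sphere 0 1 := by
  rw [Set.image_inter e.injective, e.image_ball, e.image_sphere, map_zero]

variable [MeasurableSpace E] [BorelSpace E]

theorem map_hausdorffMeasure_restrict_sphere (e : E ≃ₗᵢ[ℝ] E) (s : ℝ) :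
    ((μH[s]).restrict (Metric.sphere (0 : E) 1)).map e =
      (μH[s]).restrict (Metric.sphere (0 : E) 1) := by
  have h : MeasurePreserving e (μH[s] : Measure E) μH[s] :=
    ⟨e.continuous.measurable, e.toIsometryEquiv.map_hausdorffMeasure s⟩
  have h2 := (h.restrict_preimage (s := Metric.sphere (0 : E) 1)
    Metric.isClosed_sphere.measurableSet).map_eq
  rwa [e.preimage_sphere, map_zero] at h2

end Isometry

section SphereMeasure

variable {E : Type*} [NormedAddCommGroup E] [InnerProductSpace ℝ E] [FiniteDimensional ℝ E]
  [MeasurableSpace E] [BorelSpace E]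

variable (E) in
/-- The surface measure of polar coordinates, as a measure on the whole space. -/
noncomputable def polarSphereMeasure : Measure E :=
  ((volume : Measure E).toSphere).map Subtype.val

instance : IsFiniteMeasure (polarSphereMeasure E) :=
  inferInstanceAs (IsFiniteMeasure (Measure.map _ _))

theorem ae_norm_eq_one_polarSphereMeasure : ∀ᵐ k ∂(polarSphereMeasure E), ‖k‖ = 1 := by
  rw [polarSphereMeasure, ae_map_iff measurable_subtype_coe.aemeasurable
    (measurableSet_eq_fun measurable_norm measurable_const)]
  exact Filter.Eventually.of_forall fun k ↦ by simp

theorem lintegral_eq_polar [Nontrivial E] {Φ : E → ℝ≥0∞} (hΦ : Measurable Φ) :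
    ∫⁻ u, Φ u = ∫⁻ k, ∫⁻ r, Φ (r.1 • k) ∂(Measure.volumeIoiPow (Module.finrank ℝ E - 1))
      ∂(polarSphereMeasure E) := by
  have hm : Measurable fun p : E × Set.Ioi (0 : ℝ) ↦ Φ (p.2.1 • p.1) :=
    hΦ.comp ((measurable_subtype_coe.comp measurable_snd).smul measurable_fst)
  have hm' : Measurable fun p : Metric.sphere (0 : E) 1 × Set.Ioi (0 : ℝ) ↦
      Φ (p.2.1 • (p.1 : E)) :=
    hm.comp ((measurable_subtype_coe.comp measurable_fst).prodMk measurable_snd)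
  rw [polarSphereMeasure, lintegral_map hm.lintegral_prod_right' measurable_subtype_coe,
    ← lintegral_prod _ hm'.aemeasurable,
    ← ((volume : Measure E).measurePreserving_homeomorphUnitSphereProd).lintegral_comp hm']
  conv_lhs => rw [← restrict_compl_singleton (μ := (volume : Measure E)) 0,
    ← lintegral_subtype_comap (measurableSet_singleton _).compl]
  refine lintegral_congr fun x ↦ ?_
  have hx : ‖(x : E)‖ ≠ 0 := norm_ne_zero_iff.2 x.2
  simp [smul_smul, hx]

open scoped Pointwise in
theorem toSphere_ball_eq (x y : Metric.sphere (0 : E) 1) (r : ℝ) :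
    (volume : Measure E).toSphere (Metric.ball x r) =
      (volume : Measure E).toSphere (Metric.ball y r) := by
  obtain ⟨e, he⟩ := exists_linearIsometryEquiv_apply_eq (x := (x : E)) (y := y) (by simp)
  rw [Measure.toSphere_apply' _ measurableSet_ball, Measure.toSphere_apply' _ measurableSet_ball,
    subtype_image_ball_sphere, subtype_image_ball_sphere, ← he, ← image_ball_inter_sphere]
  congr 1
  have h1 : Set.Ioo (0 : ℝ) 1 • (e '' (Metric.ball (x : E) r ∩ Metric.sphere 0 1)) =
      e.symm ⁻¹' (Set.Ioo (0 : ℝ) 1 • (Metric.ball (x : E) r ∩ Metric.sphere 0 1)) := by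
    rw [← e.image_eq_preimage_symm]
    ext z
    simp only [Set.mem_smul, Set.mem_image]
    constructor
    · rintro ⟨t, ht, _, ⟨w, hw, rfl⟩, rfl⟩
      exact ⟨_, ⟨t, ht, w, hw, rfl⟩, by simp⟩
    · rintro ⟨_, ⟨t, ht, w, hw, rfl⟩, rfl⟩
      exact ⟨t, ht, _, ⟨w, hw, rfl⟩, by simp⟩
  rw [h1]
  exact (e.symm.measurePreserving.measure_preimage_equiv (f := e.symm.toMeasurableEquiv) _).symm

theorem hausdorffMeasure_restrict_sphere_eq_smul {n : ℕ} (hn : Module.finrank ℝ E = n + 1) :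
    ∃ c : ℝ≥0∞, (μH[(n : ℝ)]).restrict (Metric.sphere (0 : E) 1) = c • polarSphereMeasure E := by
  have : Nontrivial E := Module.nontrivial_of_finrank_pos (R := ℝ) (by omega)
  have hms : MeasurableSet (Metric.sphere (0 : E) 1) := Metric.isClosed_sphere.measurableSet
  set μ : Measure (Metric.sphere (0 : E) 1) := (μH[(n : ℝ)]).comap Subtype.val
  have hfin : IsFiniteMeasure μ := by
    refine ⟨?_⟩
    rw [comap_subtype_coe_apply hms, Set.image_univ, Subtype.range_coe]
    exact hausdorffMeasure_sphere_lt_top hn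
  have hμ : ∀ x y r, μ (Metric.ball x r) = μ (Metric.ball y r) := by
    intro x y r
    obtain ⟨e, he⟩ := exists_linearIsometryEquiv_apply_eq (x := (x : E)) (y := y) (by simp)
    rw [comap_subtype_coe_apply hms, comap_subtype_coe_apply hms, subtype_image_ball_sphere,
      subtype_image_ball_sphere, ← he, ← image_ball_inter_sphere]
    exact (e.isometry.hausdorffMeasure_image (Or.inl n.cast_nonneg) _).symm
  have key := measure_univ_smul_eq_of_uniform hμ (toSphere_ball_eq (E := E))
  set τ := (volume : Measure E).toSphere
  have hτ0 : τ Set.univ ≠ 0 := by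
    exact Measure.measure_univ_ne_zero.2 (Measure.toSphere_ne_zero (volume : Measure E))
  refine ⟨(τ Set.univ)⁻¹ * μ Set.univ, ?_⟩
  rw [← map_comap_subtype_coe hms, polarSphereMeasure, ← Measure.map_smul, mul_smul, ← key,
    smul_smul, ENNReal.inv_mul_cancel hτ0 (measure_ne_top _ _), one_smul]

theorem map_inner_hausdorffMeasure_restrict_sphere {k l : E} (h : ‖k‖ = ‖l‖) (s : ℝ) :
    ((μH[s]).restrict (Metric.sphere (0 : E) 1)).map (fun σ ↦ ⟪k, σ⟫) =
      ((μH[s]).restrict (Metric.sphere (0 : E) 1)).map (fun σ ↦ ⟪l, σ⟫) := by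
  obtain ⟨e, he⟩ := exists_linearIsometryEquiv_apply_eq h
  conv_rhs => rw [← map_hausdorffMeasure_restrict_sphere e s]
  rw [Measure.map_map (by fun_prop) e.continuous.measurable]
  congr 1
  ext σ
  simp [← he]

theorem lintegral_sphere_average [Nontrivial E] {s : Measure E} [SFinite s] {c : ℝ≥0∞}
    (hs : s = c • polarSphereMeasure E) {β : ℝ → ℝ≥0∞} (hβ : Measurable β) {A : ℝ≥0∞}
    (hA : ∀ k : E, ‖k‖ = 1 → ∫⁻ σ, β ⟪k, σ⟫ ∂s = A) {H : E → ℝ≥0∞} (hH : Measurable H) :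
    ∫⁻ u, ∫⁻ σ, β ⟪‖u‖⁻¹ • u, σ⟫ * H (‖u‖ • σ) ∂s = A * ∫⁻ u, H u := by
  set T := polarSphereMeasure E
  set ρ := Measure.volumeIoiPow (Module.finrank ℝ E - 1)
  have hm1 : Measurable fun u : E ↦ ∫⁻ σ, β ⟪‖u‖⁻¹ • u, σ⟫ * H (‖u‖ • σ) ∂s := by
    refine Measurable.lintegral_prod_right'
      (f := fun p : E × E ↦ β ⟪‖p.1‖⁻¹ • p.1, p.2⟫ * H (‖p.1‖ • p.2)) ?_
    exact (hβ.comp (by fun_prop)).mul (hH.comp (by fun_prop))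
  have hm2 : Measurable fun p : E × Set.Ioi (0 : ℝ) ↦ H (p.2.1 • p.1) :=
    hH.comp ((measurable_subtype_coe.comp measurable_snd).smul measurable_fst)
  have hm3 : Measurable fun σ : E ↦ ∫⁻ r, H (r.1 • σ) ∂ρ := hm2.lintegral_prod_right'
  have hm4 : Measurable fun p : E × E ↦ β ⟪p.1, p.2⟫ := hβ.comp (by fun_prop)
  calc ∫⁻ u, ∫⁻ σ, β ⟪‖u‖⁻¹ • u, σ⟫ * H (‖u‖ • σ) ∂s
      = ∫⁻ k, ∫⁻ r, ∫⁻ σ, β ⟪k, σ⟫ * H (r.1 • σ) ∂s ∂ρ ∂T := by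
        rw [lintegral_eq_polar hm1]
        refine lintegral_congr_ae ?_
        filter_upwards [ae_norm_eq_one_polarSphereMeasure] with k hk
        refine lintegral_congr fun r ↦ ?_
        have hr : (0 : ℝ) < r.1 := r.2
        simp [norm_smul, hk, abs_of_pos hr, smul_smul, hr.ne']
    _ = ∫⁻ k, ∫⁻ σ, β ⟪k, σ⟫ * ∫⁻ r, H (r.1 • σ) ∂ρ ∂s ∂T := by
        refine lintegral_congr fun k ↦ ?_
        rw [lintegral_lintegral_swap]
        · refine lintegral_congr fun σ ↦ ?_
          rw [lintegral_const_mul]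
          exact hH.comp (by fun_prop)
        · refine Measurable.aemeasurable (Measurable.mul ?_ (hm2.comp measurable_swap))
          exact hβ.comp (by fun_prop)
    _ = c * ∫⁻ k, ∫⁻ σ, β ⟪k, σ⟫ * ∫⁻ r, H (r.1 • σ) ∂ρ ∂T ∂T := by
        rw [← lintegral_const_mul]
        · simp_rw [hs, lintegral_smul_measure, smul_eq_mul]
        · exact Measurable.lintegral_prod_right' (hm4.mul (hm3.comp measurable_snd))
    _ = c * ∫⁻ σ, (∫⁻ k, β ⟪σ, k⟫ ∂T) * ∫⁻ r, H (r.1 • σ) ∂ρ ∂T := by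
        rw [lintegral_lintegral_swap (hm4.mul (hm3.comp measurable_snd)).aemeasurable]
        congr 1
        refine lintegral_congr fun σ ↦ ?_
        rw [lintegral_mul_const]
        · simp_rw [real_inner_comm]
        · exact hβ.comp (by fun_prop)
    _ = ∫⁻ σ, A * ∫⁻ r, H (r.1 • σ) ∂ρ ∂T := by
        rw [← lintegral_const_mul]
        · refine lintegral_congr_ae ?_
          filter_upwards [ae_norm_eq_one_polarSphereMeasure] with k hk
          rw [← mul_assoc, ← hA k hk, hs, lintegral_smul_measure, smul_eq_mul]
        · exact (hm4.lintegral_prod_right').mul hm3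
    _ = A * ∫⁻ u, H u := by
        rw [lintegral_const_mul _ hm3, lintegral_eq_polar hH]

theorem lintegral_lintegral_eq_center_relative {G : E → E → ℝ≥0∞}
    (hG : Measurable (Function.uncurry G)) :
    ∫⁻ v, ∫⁻ w, G v w =
      ∫⁻ c : E, ∫⁻ u : E, G (c + (2 : ℝ)⁻¹ • u) (c - (2 : ℝ)⁻¹ • u) := by
  have h1 : Measurable fun p : E × E ↦ G p.1 (p.1 - p.2) :=
    hG.comp_uncurry (by fun_prop) (by fun_prop)
  have h2 : Measurable fun p : E × E ↦ G (p.2 + (2 : ℝ)⁻¹ • p.1) (p.2 - (2 : ℝ)⁻¹ • p.1) :=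
    hG.comp_uncurry (by fun_prop) (by fun_prop)
  calc ∫⁻ v, ∫⁻ w, G v w = ∫⁻ v : E, ∫⁻ u : E, G v (v - u) := by
        refine lintegral_congr fun v ↦ ?_
        rw [lintegral_sub_left_eq_self (fun w ↦ G v w) v]
    _ = ∫⁻ u : E, ∫⁻ v : E, G v (v - u) := lintegral_lintegral_swap h1.aemeasurable
    _ = ∫⁻ u : E, ∫⁻ c : E, G (c + (2 : ℝ)⁻¹ • u) (c - (2 : ℝ)⁻¹ • u) := by
        refine lintegral_congr fun u ↦ ?_
        rw [← lintegral_add_right_eq_self (fun v ↦ G v (v - u)) ((2 : ℝ)⁻¹ • u)]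
        refine lintegral_congr fun c ↦ ?_
        congr 1
        module
    _ = _ := lintegral_lintegral_swap h2.aemeasurable

/-- The pre- to post-collisional change of variables. -/
theorem lintegral_collision [Nontrivial E] {s : Measure E} [SFinite s] {c : ℝ≥0∞}
    (hs : s = c • polarSphereMeasure E) {β : ℝ → ℝ≥0∞} (hβ : Measurable β) {A : ℝ≥0∞}
    (hA : ∀ k : E, ‖k‖ = 1 → ∫⁻ σ, β ⟪k, σ⟫ ∂s = A) {Θ : E → E → ℝ≥0∞}
    (hΘ : Measurable (Function.uncurry Θ)) :
    ∫⁻ v, ∫⁻ w, ∫⁻ σ, β ⟪‖v - w‖⁻¹ • (v - w), σ⟫ *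
        Θ ((2 : ℝ)⁻¹ • (v + w) + (‖v - w‖ / 2) • σ) ((2 : ℝ)⁻¹ • (v + w) - (‖v - w‖ / 2) • σ) ∂s =
      A * ∫⁻ v, ∫⁻ w, Θ v w := by
  rw [lintegral_lintegral_eq_center_relative hΘ, ← lintegral_const_mul,
    lintegral_lintegral_eq_center_relative]
  · refine lintegral_congr fun a ↦ ?_
    rw [← lintegral_sphere_average hs hβ hA (H := fun u ↦ Θ (a + (2 : ℝ)⁻¹ • u) (a - (2 : ℝ)⁻¹ • u))
      (hΘ.comp_uncurry (by fun_prop) (by fun_prop))]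
    refine lintegral_congr fun u ↦ lintegral_congr fun σ ↦ ?_
    have h1 : a + (2 : ℝ)⁻¹ • u - (a - (2 : ℝ)⁻¹ • u) = u := by module
    have h2 : (2 : ℝ)⁻¹ • (a + (2 : ℝ)⁻¹ • u + (a - (2 : ℝ)⁻¹ • u)) = a := by module
    rw [h1, h2]
    simp [smul_smul, div_eq_inv_mul]
  · refine Measurable.lintegral_prod_right' (f := fun p : (E × E) × E ↦
      β ⟪‖p.1.1 - p.1.2‖⁻¹ • (p.1.1 - p.1.2), p.2⟫ *
        Θ ((2 : ℝ)⁻¹ • (p.1.1 + p.1.2) + (‖p.1.1 - p.1.2‖ / 2) • p.2)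
          ((2 : ℝ)⁻¹ • (p.1.1 + p.1.2) - (‖p.1.1 - p.1.2‖ / 2) • p.2)) ?_
    exact (hβ.comp (by fun_prop)).mul (hΘ.comp_uncurry (by fun_prop) (by fun_prop))
  · exact Measurable.lintegral_prod_right' (f := fun p : E × E ↦
      Θ (p.1 + (2 : ℝ)⁻¹ • p.2) (p.1 - (2 : ℝ)⁻¹ • p.2))
      (hΘ.comp_uncurry (by fun_prop) (by fun_prop))

theorem lintegral_collision_add [Nontrivial E] {s : Measure E} [SFinite s] {c : ℝ≥0∞}
    (hs : s = c • polarSphereMeasure E) {β : ℝ → ℝ≥0∞} (hβ : Measurable β) {A : ℝ≥0∞}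
    (hA : ∀ k : E, ‖k‖ = 1 → ∫⁻ σ, β ⟪k, σ⟫ ∂s = A) {Θ : E → E → ℝ≥0∞}
    (hΘ : Measurable (Function.uncurry Θ)) :
    ∫⁻ v, ∫⁻ w, ((∫⁻ σ, β ⟪‖v - w‖⁻¹ • (v - w), σ⟫ *
        Θ ((2 : ℝ)⁻¹ • (v + w) + (‖v - w‖ / 2) • σ)
          ((2 : ℝ)⁻¹ • (v + w) - (‖v - w‖ / 2) • σ) ∂s) + A * Θ v w) =
      2 * (A * ∫⁻ v, ∫⁻ w, Θ v w) := by
  have hΘv (v : E) : Measurable fun w ↦ Θ v w := hΘ.comp_uncurry measurable_const measurable_id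
  have hΘ1 : Measurable fun v ↦ ∫⁻ w, Θ v w := hΘ.lintegral_prod_right'
  simp_rw [fun v ↦ lintegral_add_right (μ := volume) (fun w ↦ ∫⁻ σ, β ⟪‖v - w‖⁻¹ • (v - w), σ⟫ *
      Θ ((2 : ℝ)⁻¹ • (v + w) + (‖v - w‖ / 2) • σ)
        ((2 : ℝ)⁻¹ • (v + w) - (‖v - w‖ / 2) • σ) ∂s) ((hΘv v).const_mul A),
    fun v ↦ lintegral_const_mul (μ := volume) A (hΘv v)]
  rw [lintegral_add_right _ (hΘ1.const_mul A), lintegral_const_mul _ hΘ1,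
    lintegral_collision hs hβ hA hΘ, two_mul]

end SphereMeasure

theorem enorm_integral_mul_le_lintegral {X : Type*} [MeasurableSpace X] {μ : Measure X}
    {p : X → ℝ} {b : ℝ → ℝ} {β : ℝ → ℝ≥0∞}
    (hβ : ∀ h : X → ℝ≥0∞, AEMeasurable h μ → h ≤ (fun t ↦ ENNReal.ofReal (b t)) ∘ p →
      h ≤ᵐ[μ] β ∘ p)
    (hb : ∀ t, 0 ≤ b t) {K : ℝ} (hK : 0 ≤ K) {Ψ : X → ℂ} (hΨ : AEStronglyMeasurable Ψ μ) :
    ‖∫ x, ((K * b (p x) : ℝ) : ℂ) * Ψ x ∂μ‖ₑ ≤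
      ∫⁻ x, β (p x) * (ENNReal.ofReal K * ‖Ψ x‖ₑ) ∂μ := by
  by_cases hF : AEStronglyMeasurable (fun x ↦ ((K * b (p x) : ℝ) : ℂ) * Ψ x) μ
  · refine (enorm_integral_le_lintegral_enorm _).trans (lintegral_mono_ae ?_)
    have hnorm : ∀ x, ‖((K * b (p x) : ℝ) : ℂ) * Ψ x‖ₑ =
        ENNReal.ofReal (b (p x)) * (ENNReal.ofReal K * ‖Ψ x‖ₑ) := by
      intro x
      rw [enorm_mul, ← ofReal_norm, Complex.norm_real, Real.norm_of_nonneg (mul_nonneg hK (hb _)),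
        ENNReal.ofReal_mul hK]
      ring
    have h := hβ (fun x ↦ ‖((K * b (p x) : ℝ) : ℂ) * Ψ x‖ₑ / (ENNReal.ofReal K * ‖Ψ x‖ₑ))
      (hF.enorm.div (hΨ.enorm.const_mul _))
      (fun x ↦ ENNReal.div_le_of_le_mul (hnorm x).le)
    filter_upwards [h] with x hx
    rcases eq_or_ne (ENNReal.ofReal K * ‖Ψ x‖ₑ) 0 with h0 | h0
    · rw [hnorm, h0, mul_zero, mul_zero]
    · exact (ENNReal.div_le_iff h0 (by finiteness)).1 hx
  · rw [integral_non_aestronglyMeasurable hF, enorm_zero]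
    exact zero_le

theorem ae_ae_ae_collision {E X Y : Type*} [NormedAddCommGroup E] [InnerProductSpace ℝ E]
    [FiniteDimensional ℝ E] [MeasurableSpace E] [BorelSpace E] [Nontrivial E] {s : Measure E}
    [SFinite s] {c : ℝ≥0∞} (hs : s = c • polarSphereMeasure E) {f f' : E → X} {g g' : E → Y}
    (hf : ∀ᵐ v, f v = f' v) (hg : ∀ᵐ v, g v = g' v) :
    ∀ᵐ v : E, ∀ᵐ w : E, ∀ᵐ σ ∂s,
      f ((2 : ℝ)⁻¹ • (v + w) + (‖v - w‖ / 2) • σ) =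
        f' ((2 : ℝ)⁻¹ • (v + w) + (‖v - w‖ / 2) • σ) ∧
      g ((2 : ℝ)⁻¹ • (v + w) - (‖v - w‖ / 2) • σ) =
        g' ((2 : ℝ)⁻¹ • (v + w) - (‖v - w‖ / 2) • σ) := by
  set M := toMeasurable volume {v | f v ≠ f' v}
  set N := toMeasurable volume {v | g v ≠ g' v}
  have hM : MeasurableSet M := measurableSet_toMeasurable _ _
  have hN : MeasurableSet N := measurableSet_toMeasurable _ _
  have hM0 : volume M = 0 := (measure_toMeasurable _).trans hf
  have hN0 : volume N = 0 := (measure_toMeasurable _).trans hg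
  set Θ : E → E → ℝ≥0∞ := fun v w ↦ M.indicator 1 v + N.indicator 1 w
  have hΘ : Measurable (Function.uncurry Θ) :=
    ((measurable_one.indicator hM).comp measurable_fst).add
      ((measurable_one.indicator hN).comp measurable_snd)
  have hΘ0 : ∫⁻ v, ∫⁻ w, Θ v w = 0 := by
    have h1 : ∀ᵐ v, M.indicator (1 : E → ℝ≥0∞) v = 0 :=
      (measure_eq_zero_iff_ae_notMem.1 hM0).mono fun v hv ↦ by simp [hv]
    have h2 : ∀ᵐ v, N.indicator (1 : E → ℝ≥0∞) v = 0 :=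
      (measure_eq_zero_iff_ae_notMem.1 hN0).mono fun v hv ↦ by simp [hv]
    have hΘv (v : E) : Measurable fun w ↦ Θ v w := hΘ.comp_uncurry measurable_const measurable_id
    have hΘ1 : Measurable fun v ↦ ∫⁻ w, Θ v w := hΘ.lintegral_prod_right'
    rw [lintegral_eq_zero_iff hΘ1]
    filter_upwards [h1] with v hv
    simp only [Pi.zero_apply]
    rw [lintegral_eq_zero_iff (hΘv v)]
    filter_upwards [h2] with w hw
    simp [Θ, hv, hw]
  have hcol := lintegral_collision hs (β := fun _ ↦ 1) measurable_const (A := ∫⁻ _, 1 ∂s)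
    (fun _ _ ↦ rfl) hΘ
  simp only [one_mul, hΘ0, mul_zero] at hcol
  have hm : Measurable fun p : (E × E) × E ↦
      Θ ((2 : ℝ)⁻¹ • (p.1.1 + p.1.2) + (‖p.1.1 - p.1.2‖ / 2) • p.2)
        ((2 : ℝ)⁻¹ • (p.1.1 + p.1.2) - (‖p.1.1 - p.1.2‖ / 2) • p.2) :=
    hΘ.comp_uncurry (by fun_prop) (by fun_prop)
  have hm2 : Measurable fun p : E × E ↦ ∫⁻ σ,
      Θ ((2 : ℝ)⁻¹ • (p.1 + p.2) + (‖p.1 - p.2‖ / 2) • σ)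
        ((2 : ℝ)⁻¹ • (p.1 + p.2) - (‖p.1 - p.2‖ / 2) • σ) ∂s := hm.lintegral_prod_right'
  have hm3 : Measurable fun v : E ↦ ∫⁻ w : E, ∫⁻ σ,
      Θ ((2 : ℝ)⁻¹ • (v + w) + (‖v - w‖ / 2) • σ)
        ((2 : ℝ)⁻¹ • (v + w) - (‖v - w‖ / 2) • σ) ∂s := hm2.lintegral_prod_right'
  have hm4 (v : E) : Measurable fun w : E ↦ ∫⁻ σ,
      Θ ((2 : ℝ)⁻¹ • (v + w) + (‖v - w‖ / 2) • σ)
        ((2 : ℝ)⁻¹ • (v + w) - (‖v - w‖ / 2) • σ) ∂s := hm2.comp measurable_prodMk_left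
  rw [lintegral_eq_zero_iff hm3] at hcol
  filter_upwards [hcol] with v hv
  simp only [Pi.zero_apply] at hv
  rw [lintegral_eq_zero_iff (hm4 v)] at hv
  filter_upwards [hv] with w hw
  simp only [Pi.zero_apply] at hw
  rw [lintegral_eq_zero_iff (hΘ.comp_uncurry (by fun_prop) (by fun_prop))] at hw
  filter_upwards [hw] with σ hσ
  simp only [Θ, Pi.zero_apply, add_eq_zero, Set.indicator_apply_eq_zero, Pi.one_apply,
    one_ne_zero, imp_false] at hσ
  constructor
  · by_contra h
    exact hσ.1 (subset_toMeasurable _ _ h)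
  · by_contra h
    exact hσ.2 (subset_toMeasurable _ _ h)

theorem lintegral_enorm_collision_le {E : Type*} [NormedAddCommGroup E] [InnerProductSpace ℝ E]
    [FiniteDimensional ℝ E] [MeasurableSpace E] [BorelSpace E] [Nontrivial E] {s : Measure E}
    [IsFiniteMeasure s] {c : ℝ≥0∞} (hs : s = c • polarSphereMeasure E) (hnormσ : ∀ᵐ σ ∂s, ‖σ‖ = 1)
    (hmap : ∀ l k : E, ‖l‖ = 1 → ‖k‖ = 1 → s.map (fun σ ↦ ⟪l, σ⟫) = s.map (fun σ ↦ ⟪k, σ⟫))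
    {lam : ℝ} {b : ℝ → ℝ} (hb : ∀ x, 0 ≤ b x) {f g : E → ℂ}
    (hf : AEStronglyMeasurable f) (hg : AEStronglyMeasurable g) {C : ℝ≥0∞}
    (hC : ∀ v, ∫⁻ w, ‖v - w‖ₑ ^ (-lam) * ‖f w‖ₑ ≤ C) {k : E} (hk : ‖k‖ = 1) :
    ∫⁻ v, ‖∫ w, ∫ σ, ((‖v - w‖ ^ (-lam) * b ⟪‖v - w‖⁻¹ • (v - w), σ⟫ : ℝ) : ℂ) *
        (f ((2 : ℝ)⁻¹ • (v + w) + (‖v - w‖ / 2) • σ) *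
          g ((2 : ℝ)⁻¹ • (v + w) - (‖v - w‖ / 2) • σ) - f v * g w) ∂s‖ₑ ≤
      2 * ((∫⁻ σ, ENNReal.ofReal (b ⟪k, σ⟫) ∂s) * (C * ∫⁻ w, ‖g w‖ₑ)) := by
  obtain ⟨β, hβ, hβb, hmax⟩ := exists_measurable_le_forall_ae_le (X := E)
    (s.map fun σ ↦ ⟪k, σ⟫) (fun t ↦ ENNReal.ofReal (b t))
  set A : ℝ≥0∞ := ∫⁻ σ, β ⟪k, σ⟫ ∂s with hA_def
  have hA : ∀ l : E, ‖l‖ = 1 → ∫⁻ σ, β ⟪l, σ⟫ ∂s = A := by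
    intro l hl
    rw [hA_def, ← lintegral_map (g := fun σ : E ↦ ⟪l, σ⟫) hβ (by fun_prop),
      ← lintegral_map (g := fun σ : E ↦ ⟪k, σ⟫) hβ (by fun_prop), hmap l k hl hk]
  have hAb : A ≤ ∫⁻ σ, ENNReal.ofReal (b ⟪k, σ⟫) ∂s := lintegral_mono fun σ ↦ hβb _
  set f₀ := hf.mk f
  set g₀ := hg.mk g
  have hf₀ : Measurable f₀ := hf.stronglyMeasurable_mk.measurable
  have hg₀ : Measurable g₀ := hg.stronglyMeasurable_mk.measurable
  have hff : ∀ᵐ v, f v = f₀ v := hf.ae_eq_mk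
  have hgg : ∀ᵐ v, g v = g₀ v := hg.ae_eq_mk
  set Θ : E → E → ℝ≥0∞ := fun v w ↦ ‖v - w‖ₑ ^ (-lam) * (‖f₀ v‖ₑ * ‖g₀ w‖ₑ)
  have hΘ : Measurable (Function.uncurry Θ) := by
    have h1 : Measurable fun p : E × E ↦ ‖p.1 - p.2‖ₑ ^ (-lam) := by fun_prop
    exact h1.mul ((hf₀.comp measurable_fst).enorm.mul (hg₀.comp measurable_snd).enorm)
  have hΘC : ∫⁻ v, ∫⁻ w, Θ v w ≤ C * ∫⁻ w, ‖g w‖ₑ := by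
    rw [lintegral_lintegral_swap hΘ.aemeasurable]
    have hL : ∫⁻ w, ‖g w‖ₑ = ∫⁻ w, ‖g₀ w‖ₑ :=
      lintegral_congr_ae (hgg.mono fun w hw ↦ by simp only [hw])
    rw [hL, ← lintegral_const_mul _ hg₀.enorm]
    refine lintegral_mono fun w ↦ ?_
    calc ∫⁻ v, Θ v w = ∫⁻ v, ‖w - v‖ₑ ^ (-lam) * ‖f v‖ₑ * ‖g₀ w‖ₑ := by
          refine lintegral_congr_ae (hff.mono fun v hv ↦ ?_)
          simp only [Θ, hv, mul_assoc, enorm_sub_rev w v]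
      _ = (∫⁻ v, ‖w - v‖ₑ ^ (-lam) * ‖f v‖ₑ) * ‖g₀ w‖ₑ := by
          rw [lintegral_mul_const' _ _ (by finiteness)]
      _ ≤ C * ‖g₀ w‖ₑ := by gcongr; exact hC w
  set P : E → E → E → E := fun v w σ ↦ (2 : ℝ)⁻¹ • (v + w) + (‖v - w‖ / 2) • σ
  set P' : E → E → E → E := fun v w σ ↦ (2 : ℝ)⁻¹ • (v + w) - (‖v - w‖ / 2) • σ
  have hpost : ∀ᵐ v : E, ∀ᵐ w : E, ∀ᵐ σ ∂s,
      f (P v w σ) = f₀ (P v w σ) ∧ g (P' v w σ) = g₀ (P' v w σ) :=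
    ae_ae_ae_collision hs hff hgg
  have hunit : ∀ v w : E, v ≠ w → ‖‖v - w‖⁻¹ • (v - w)‖ = 1 := by
    intro v w hvw
    have : ‖v - w‖ ≠ 0 := norm_ne_zero_iff.2 (sub_ne_zero.2 hvw)
    rw [norm_smul, norm_inv, norm_norm, inv_mul_cancel₀ this]
  have hpt : ∀ᵐ v : E, ∀ᵐ w : E,
      ‖∫ σ, ((‖v - w‖ ^ (-lam) * b ⟪‖v - w‖⁻¹ • (v - w), σ⟫ : ℝ) : ℂ) *
        (f (P v w σ) * g (P' v w σ) - f v * g w) ∂s‖ₑ ≤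
      (∫⁻ σ, β ⟪‖v - w‖⁻¹ • (v - w), σ⟫ * Θ (P v w σ) (P' v w σ) ∂s) + A * Θ v w := by
    filter_upwards [hpost, hff] with v hv hfv
    filter_upwards [hv, hgg, compl_mem_ae_iff.2 (measure_singleton v)] with w hw hgw hne
    have hvw : v ≠ w := fun h ↦ hne h.symm
    have hu := hunit v w hvw
    have hpos : 0 < ‖v - w‖ := norm_pos_iff.2 (sub_ne_zero.2 hvw)
    have hΨ₀ : Measurable fun σ ↦ f₀ (P v w σ) * g₀ (P' v w σ) - f v * g w :=
      ((hf₀.comp (by fun_prop)).mul (hg₀.comp (by fun_prop))).sub_const _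
    have hΨ : AEStronglyMeasurable (fun σ ↦ f (P v w σ) * g (P' v w σ) - f v * g w) s := by
      refine ⟨_, hΨ₀.stronglyMeasurable, ?_⟩
      filter_upwards [hw] with σ hσ
      rw [hσ.1, hσ.2]
    refine (enorm_integral_mul_le_lintegral (hmax s
      (fun σ ↦ ⟪‖v - w‖⁻¹ • (v - w), σ⟫) (by fun_prop) (hmap _ _ hu hk)) hb
      (Real.rpow_nonneg hpos.le _) hΨ).trans ?_
    have hK : ENNReal.ofReal (‖v - w‖ ^ (-lam)) = ‖v - w‖ₑ ^ (-lam) := by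
      rw [← ENNReal.ofReal_rpow_of_pos hpos, ofReal_norm]
    have hβm : Measurable fun σ : E ↦ β ⟪‖v - w‖⁻¹ • (v - w), σ⟫ := hβ.comp (by fun_prop)
    rw [← hA _ hu, ← lintegral_mul_const _ hβm, ← lintegral_add_right _ (hβm.mul_const _)]
    refine lintegral_mono_ae ?_
    filter_upwards [hw, hnormσ] with σ hσ hσ1
    have hrel : ‖P v w σ - P' v w σ‖ₑ = ‖v - w‖ₑ := by
      have : P v w σ - P' v w σ = ‖v - w‖ • σ := by
        simp only [P, P']
        module
      rw [this, enorm_smul, enorm_norm, ← ofReal_norm σ, hσ1, ENNReal.ofReal_one, mul_one]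
    rw [← mul_add]
    gcongr
    simp only [Θ, hrel, hK, ← mul_add, hσ.1, hσ.2, hfv, hgw]
    gcongr
    rw [← enorm_mul, ← enorm_mul]
    exact enorm_sub_le
  calc _ ≤ ∫⁻ v, ∫⁻ w, ((∫⁻ σ, β ⟪‖v - w‖⁻¹ • (v - w), σ⟫ * Θ (P v w σ) (P' v w σ) ∂s) +
          A * Θ v w) := by
        refine lintegral_mono_ae (hpt.mono fun v hv ↦ ?_)
        exact (enorm_integral_le_lintegral_enorm _).trans (lintegral_mono_ae hv)
    _ = 2 * (A * ∫⁻ v, ∫⁻ w, Θ v w) := lintegral_collision_add hs hβ hA hΘ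
    _ ≤ _ := by gcongr

theorem lintegral_enorm_Qop_le {n : ℕ} {lam : ℝ} {b : ℝ → ℝ}
    (hb : ∀ x, 0 ≤ b x) {f g : EuclideanSpace ℝ (Fin (n + 1)) → ℂ}
    (hf : AEStronglyMeasurable f) (hg : AEStronglyMeasurable g) {C : ℝ≥0∞}
    (hC : ∀ v, ∫⁻ w, ‖v - w‖ₑ ^ (-lam) * ‖f w‖ₑ ≤ C)
    {k : EuclideanSpace ℝ (Fin (n + 1))} (hk : ‖k‖ = 1) :
    ∫⁻ v, ‖Qop (n + 1) lam b f g v‖ₑ ≤ 2 * (bL1 (n + 1) b k * (C * L1e (n + 1) g)) := by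
  have hn : Module.finrank ℝ (EuclideanSpace ℝ (Fin (n + 1))) = n + 1 := by simp
  have hsph : sph (n + 1) =
      (μH[(n : ℝ)]).restrict (Metric.sphere (0 : EuclideanSpace ℝ (Fin (n + 1))) 1) := by
    simp [sph]
  obtain ⟨c, hc⟩ := hausdorffMeasure_restrict_sphere_eq_smul hn
  rw [← hsph] at hc
  have hfin : IsFiniteMeasure (sph (n + 1)) := by
    rw [hsph]
    exact ⟨by simpa using hausdorffMeasure_sphere_lt_top hn⟩
  refine lintegral_enorm_collision_le hc ?_ (fun l k hl hk ↦ ?_) hb hf hg hC hk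
  · rw [hsph]
    filter_upwards [ae_restrict_mem Metric.isClosed_sphere.measurableSet] with σ hσ
    simpa using hσ
  · rw [hsph]
    exact map_inner_hausdorffMeasure_restrict_sphere (hl.trans hk.symm) _

theorem stmt10 (d : ℕ) (hd : 1 ≤ d) (lam α : ℝ) (hlam0 : 0 < lam) (hlamd : lam < d)
    (hα1 : lam < (d : ℝ) / 2 → 0 ≤ α)
    (hα2 : (d : ℝ) / 2 ≤ lam → α > lam - (d : ℝ) / 2)
    (b : ℝ → ℝ) (hb : ∀ x, 0 ≤ b x) (CJ : ℝ≥0)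
    (hCJ : ∀ f : EuclideanSpace ℝ (Fin d) → ℂ, Integrable f → He d α f ≠ ⊤ →
      ∀ v : EuclideanSpace ℝ (Fin d),
        (∫⁻ w, (‖v - w‖₊ : ℝ≥0∞) ^ (-lam) * (‖f w‖₊ : ℝ≥0∞)) ≤
          CJ * L1e d f ^ (1 - 2 * lam / ((d : ℝ) + 2 * α)) *
            He d α f ^ (2 * lam / ((d : ℝ) + 2 * α))) :
    ∀ f g : EuclideanSpace ℝ (Fin d) → ℂ, Integrable f → Integrable g →
      He d α f ≠ ⊤ → He d α g ≠ ⊤ →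
      ∀ k : EuclideanSpace ℝ (Fin d), ‖k‖ = 1 →
        (∫⁻ v, ‖Qop d lam b f g v‖₊) ≤
          2 * CJ * bL1 d b k * L1e d f ^ (1 - 2 * lam / ((d : ℝ) + 2 * α)) *
            He d α f ^ (2 * lam / ((d : ℝ) + 2 * α)) * L1e d g := by
  obtain ⟨n, rfl⟩ := Nat.exists_eq_add_of_le' hd
  intro f g hf hg hHf _ k hk
  refine (lintegral_enorm_Qop_le hb hf.1 hg.1 (hCJ f hf hHf) hk).trans_eq ?_
  ring
end
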